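/- arXiv:1711.02147 — 4 statements merged into one kernel-verified Lean document; each statement's English description precedes it below -/
import Mathlib

section
/- Let n be a prime and F a field. An irreducible solvable subgroup G of GL(n,F) has derived length at most 6. -/
open Matrix

/-- `SL n R` : the special linear group of `n × n` matrices over `R`. -/
abbrev SL (n : ℕ) (R : Type*) [CommRing R] := Matrix.SpecialLinearGroup (Fin n) R

/-- The reduction-mod-`p` homomorphism `φ_p : SL(n,ℤ) → SL(n,ℤ/pℤ)`. -/
def redMod (n p : ℕ) : SL n ℤ →* SL n (ZMod p) :=
  Matrix.SpecialLinearGroup.map (Int.castRingHom (ZMod p))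

/-- The rational matrix underlying an element of `SL(n,ℤ)`. -/
def matQ {n : ℕ} (g : SL n ℤ) : Matrix (Fin n) (Fin n) ℚ :=
  (g : Matrix (Fin n) (Fin n) ℤ).map ((↑) : ℤ → ℚ)

/-- A subgroup of `SL(n,ℤ)` is absolutely irreducible over `ℚ` if its elements generate the
full matrix algebra over `ℚ`. -/
def AbsIrredQ {n : ℕ} (H : Subgroup (SL n ℤ)) : Prop :=
  Algebra.adjoin ℚ (matQ '' (H : Set (SL n ℤ))) = ⊤

/-- A subgroup of `SL(n, ℤ/pℤ)` is absolutely irreducible if its elements generate the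
full matrix algebra over `ℤ/pℤ`. -/
def AbsIrredMod {n p : ℕ} (G : Subgroup (SL n (ZMod p))) : Prop :=
  Algebra.adjoin (ZMod p)
    ((fun g : SL n (ZMod p) => (g : Matrix (Fin n) (Fin n) (ZMod p))) '' (G : Set _)) = ⊤

/-- Irreducibility of the natural action of a subgroup of `SL(n,R)` on `R^n`. -/
def IrreducibleSub (R : Type*) [CommRing R] {n : ℕ} (G : Subgroup (SL n R)) : Prop :=
  ∀ W : Submodule R (Fin n → R),
    (∀ g ∈ G, W.map (Matrix.toLin' (g : Matrix (Fin n) (Fin n) R)) ≤ W) → W = ⊥ ∨ W = ⊤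

/-- Imprimitivity: a nontrivial direct-sum decomposition whose summands are permuted by `G`. -/
def ImprimitiveSub (R : Type*) [CommRing R] {n : ℕ} (G : Subgroup (SL n R)) : Prop :=
  ∃ m : ℕ, 2 ≤ m ∧ ∃ W : Fin m → Submodule R (Fin n → R),
    (∀ i, W i ≠ ⊥) ∧ DirectSum.IsInternal W ∧
    ∀ g ∈ G, ∀ i, ∃ j, (W i).map (Matrix.toLin' (g : Matrix (Fin n) (Fin n) R)) = W j

/-- Primitivity: irreducible and not imprimitive. -/
def PrimitiveSub (R : Type*) [CommRing R] {n : ℕ} (G : Subgroup (SL n R)) : Prop :=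
  IrreducibleSub R G ∧ ¬ ImprimitiveSub R G

/-- Monomiality: a direct sum of `n` one-dimensional subspaces permuted by `G`. -/
def MonomialSub (R : Type*) [CommRing R] {n : ℕ} (G : Subgroup (SL n R)) : Prop :=
  ∃ L : Fin n → Submodule R (Fin n → R),
    (∀ i, Module.finrank R (L i) = 1) ∧ DirectSum.IsInternal L ∧
    ∀ g ∈ G, ∀ i, ∃ j, (L i).map (Matrix.toLin' (g : Matrix (Fin n) (Fin n) R)) = L j

/-- Irreducibility of a subgroup of `SL(n,ℤ)` acting on `ℚ^n`. -/
def IrreducibleQ {n : ℕ} (H : Subgroup (SL n ℤ)) : Prop :=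
  ∀ W : Submodule ℚ (Fin n → ℚ),
    (∀ g ∈ H, W.map (Matrix.toLin' (matQ g)) ≤ W) → W = ⊥ ∨ W = ⊤

/-- Imprimitivity of a subgroup of `SL(n,ℤ)` acting on `ℚ^n`. -/
def ImprimitiveQ {n : ℕ} (H : Subgroup (SL n ℤ)) : Prop :=
  ∃ m : ℕ, 2 ≤ m ∧ ∃ W : Fin m → Submodule ℚ (Fin n → ℚ),
    (∀ i, W i ≠ ⊥) ∧ DirectSum.IsInternal W ∧
    ∀ g ∈ H, ∀ i, ∃ j, (W i).map (Matrix.toLin' (matQ g)) = W j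

/-- Primitivity of a subgroup of `SL(n,ℤ)` acting on `ℚ^n`. -/
def PrimitiveQ {n : ℕ} (H : Subgroup (SL n ℤ)) : Prop :=
  IrreducibleQ H ∧ ¬ ImprimitiveQ H

/-- A group is solvable-by-finite if it has a solvable subgroup of finite index. -/
def SolvableByFinite (G : Type*) [Group G] : Prop :=
  ∃ K : Subgroup G, IsSolvable K ∧ K.FiniteIndex

/-- A subgroup of `SL(n,ℤ)` is an isometry group if it preserves a nondegenerate bilinear
form on `ℚ^n`. -/
def IsometryGroupQ {n : ℕ} (H : Subgroup (SL n ℤ)) : Prop :=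
  ∃ Φ : Matrix (Fin n) (Fin n) ℚ, IsUnit Φ ∧ ∀ h ∈ H, matQ h * Φ * (matQ h)ᵀ = Φ
/-- Irreducibility of the natural action of a subgroup of `GL(n,F)` on `F^n`. -/
def IrreducibleGL (F : Type*) [Field F] {n : ℕ} (G : Subgroup (GL (Fin n) F)) : Prop :=
  ∀ W : Submodule F (Fin n → F),
    (∀ g ∈ G, W.map (Matrix.toLin' (g : Matrix (Fin n) (Fin n) F)) ≤ W) → W = ⊥ ∨ W = ⊤

section DerivedLengthAux

open Subgroup
open scoped commutatorElement

theorem aux_exists_last {G : Type*} [Group G] [hs : Group.IsSolvable G] (K : Subgroup G) (hK : K ≠ ⊤) :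
    ∃ k, ¬ derivedSeries G k ≤ K ∧ derivedSeries G (k + 1) ≤ K := by
  classical
  have hex : ∃ m, derivedSeries G m ≤ K := by
    obtain ⟨m, hm⟩ := hs.solvable
    exact ⟨m, by rw [hm]; exact bot_le⟩
  have h0 : Nat.find hex ≠ 0 := by
    intro h
    have := Nat.find_spec hex
    rw [h, derivedSeries_zero, top_le_iff] at this
    exact hK this
  obtain ⟨k, hk⟩ := Nat.exists_eq_succ_of_ne_zero h0
  refine ⟨k, Nat.find_min hex (by omega), ?_⟩
  have := Nat.find_spec hex
  rw [hk] at this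
  exact this

theorem aux_perm_faithful {G X : Type*} [Group G] [Group.IsSolvable G] [MulAction G X]
    [FaithfulSMul G X] [MulAction.IsPretransitive G X] (hp : (Nat.card X).Prime) :
    derivedSeries G 2 = ⊥ := by
  classical
  by_cases htriv : (⊥ : Subgroup G) = ⊤
  · exact le_bot_iff.1 (htriv ▸ le_top)
  obtain ⟨k, hk1, hk2⟩ := aux_exists_last (⊥ : Subgroup G) htriv
  set N := derivedSeries G k with hN
  have hNn : N.Normal := derivedSeries_normal G k
  have hcomm : ∀ a ∈ N, ∀ b ∈ N, a * b = b * a := by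
    intro a ha b hb
    rw [← commutatorElement_eq_one_iff_mul_comm]
    exact hk2 (commutator_mem_commutator ha hb)
  have hprim : MulAction.IsPreprimitive G X := MulAction.IsPreprimitive.of_prime_card hp
  have htr : MulAction.IsPretransitive N X := by
    apply MulAction.IsQuasiPreprimitive.isPretransitive_of_normal (G := G)
    intro h
    apply hk1
    intro g hg
    rw [mem_bot]
    apply FaithfulSMul.eq_of_smul_eq_smul (α := X)
    intro x
    have : x ∈ MulAction.fixedPoints N X := h ▸ Set.mem_univ x
    rw [one_smul]
    exact this ⟨g, hg⟩
  obtain ⟨hne, hfin⟩ := Nat.card_pos_iff.1 hp.pos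
  obtain ⟨x⟩ := hne
  have hcent : ∀ c : G, (∀ b ∈ N, b * c = c * b) → c ∈ N := by
    intro c hc
    obtain ⟨m, hm⟩ := MulAction.exists_smul_eq N x (c • x)
    have : c = m := by
      apply FaithfulSMul.eq_of_smul_eq_smul (α := X)
      intro y
      obtain ⟨l, rfl⟩ := MulAction.exists_smul_eq N x y
      change c • ((l : G) • x) = (m : G) • ((l : G) • x)
      rw [smul_smul, ← hc l l.2, mul_smul, ← hm, smul_smul, hcomm m m.2 l l.2, mul_smul]
      rfl
    rw [this]; exact m.2
  have hcard : Nat.card N = Nat.card X := by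
    apply Nat.card_congr
    refine Equiv.ofBijective (fun m : N => m • x) ⟨?_, fun y => MulAction.exists_smul_eq N x y⟩
    intro m m' h
    apply Subtype.ext
    apply FaithfulSMul.eq_of_smul_eq_smul (α := X)
    intro y
    obtain ⟨l, rfl⟩ := MulAction.exists_smul_eq N x y
    change (m : G) • ((l : G) • x) = (m' : G) • ((l : G) • x)
    have h' : (m : G) • x = (m' : G) • x := h
    rw [smul_smul, smul_smul, hcomm m m.2 l l.2, hcomm m' m'.2 l l.2, mul_smul, h', mul_smul]
  have : Fact (Nat.card X).Prime := ⟨hp⟩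
  have : IsCyclic N := isCyclic_of_prime_card hcard
  have hpow : ∀ g : G, ∃ z : ℤ, ∀ b : N, MulAut.conjNormal g b = b ^ z := by
    intro g
    obtain ⟨z, hz⟩ := MonoidHom.map_cyclic ((MulAut.conjNormal g : N ≃* N) : N →* N)
    exact ⟨z, fun b => hz b⟩
  have hD1 : derivedSeries G 1 ≤ N := by
    rw [derivedSeries_succ, Subgroup.commutator_le]
    intro g _ h _
    apply hcent
    intro b hb
    -- replace `b` by its conjugate
    have key3 : ∀ b ∈ N, g * h * b * (g * h)⁻¹ = h * g * b * (h * g)⁻¹ := by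
      intro b hb
      have key : MulAut.conjNormal (g * h) (⟨b, hb⟩ : N) = MulAut.conjNormal (h * g) ⟨b, hb⟩ := by
        obtain ⟨z, hz⟩ := hpow g
        obtain ⟨w, hw⟩ := hpow h
        rw [map_mul, map_mul, MulAut.mul_apply, MulAut.mul_apply, hz, hw, hw, hz, ← _root_.zpow_mul,
          ← _root_.zpow_mul, mul_comm]
      simpa [MulAut.conjNormal_apply, mul_assoc] using congrArg Subtype.val key
    have hb' := key3 ((h * g)⁻¹ * b * (h * g)) (by simpa using hNn.conj_mem b hb (h * g)⁻¹)
    have e : ⁅g, h⁆ * b * ⁅g, h⁆⁻¹ = b := by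
      calc ⁅g, h⁆ * b * ⁅g, h⁆⁻¹ = g * h * ((h * g)⁻¹ * b * (h * g)) * (g * h)⁻¹ := by
            simp [commutatorElement_def, mul_assoc]
        _ = b := by rw [hb']; group
    calc b * ⁅g, h⁆ = ⁅g, h⁆ * b * ⁅g, h⁆⁻¹ * ⁅g, h⁆ := by rw [e]
      _ = ⁅g, h⁆ * b := by group
  rw [derivedSeries_succ, eq_bot_iff, Subgroup.commutator_le]
  intro a ha b hb
  rw [mem_bot, commutatorElement_eq_one_iff_mul_comm]
  exact hcomm a (hD1 ha) b (hD1 hb)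

theorem aux_derivedSeries_map_mem {G H : Type*} [Group G] [Group H] (f : G →* H) (k : ℕ) {g : G}
    (hg : g ∈ derivedSeries G k) : f g ∈ derivedSeries H k :=
  map_derivedSeries_le_derivedSeries f k (Subgroup.mem_map_of_mem f hg)

theorem aux_derivedSeries_ker {G H : Type*} [Group G] [Group H] (f : G →* H) (k : ℕ)
    (h : derivedSeries f.range k = ⊥) : derivedSeries G k ≤ f.ker := by
  intro g hg
  have := aux_derivedSeries_map_mem f.rangeRestrict k hg
  rw [h, mem_bot] at this
  exact congrArg Subtype.val this

theorem aux_perm {G X : Type*} [Group G] [Group.IsSolvable G] [MulAction G X]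
    [MulAction.IsPretransitive G X] (hp : (Nat.card X).Prime) :
    ∀ g ∈ derivedSeries G 2, ∀ x : X, g • x = x := by
  let f := MulAction.toPermHom G X
  have : Group.IsSolvable f.range := Group.isSolvable_of_surjective f.rangeRestrict_surjective
  have : MulAction.IsPretransitive f.range X := by
    constructor
    intro x y
    obtain ⟨g, hg⟩ := MulAction.exists_smul_eq G x y
    exact ⟨⟨f g, g, rfl⟩, hg⟩
  have := aux_derivedSeries_ker f 2 (aux_perm_faithful (X := X) hp)
  intro g hg x
  exact congrArg (fun e : Equiv.Perm X => e x) (this hg)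

theorem aux_s3 {X : Type*} (hX : Nat.card X = 3) : derivedSeries (Equiv.Perm X) 2 = ⊥ := by
  have : Finite X := Nat.finite_of_card_ne_zero (by omega)
  let e : X ≃ Fin 3 := Finite.equivFinOfCardEq hX
  have h4 : derivedSeries (Equiv.Perm (Fin 3)) 2 = ⊥ := by
    have h5 : derivedSeries (Equiv.Perm (Fin 3)) 1 ≤ alternatingGroup (Fin 3) := by
      rw [derivedSeries_succ, Subgroup.commutator_le]
      intro a _ b _
      rw [Equiv.Perm.mem_alternatingGroup, map_commutatorElement,
        commutatorElement_eq_one_iff_mul_comm, mul_comm]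
    have h6 : ∀ a b : Equiv.Perm (Fin 3), Equiv.Perm.sign a = 1 → Equiv.Perm.sign b = 1 → ⁅a, b⁆ = 1 := by
      decide +kernel
    rw [derivedSeries_succ, eq_bot_iff, Subgroup.commutator_le]
    intro a ha b hb
    exact h6 a b (h5 ha) (h5 hb)
  rw [eq_bot_iff]
  intro g hg
  have := aux_derivedSeries_map_mem (e.permCongrHom : Equiv.Perm X ≃* Equiv.Perm (Fin 3)).toMonoidHom 2 hg
  rw [h4, mem_bot] at this
  exact (MulEquiv.map_eq_one_iff (e.permCongrHom)).1 this

theorem aux_equiv (n : ℕ) [Fact n.Prime] (A : Type*) [AddCommGroup A] [Finite A]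
    [Module (ZMod n) A] (h : Module.finrank (ZMod n) A = 2) :
    Nonempty (A ≃ₗ[ZMod n] (Fin 2 → ZMod n)) :=
  have : Module.Finite (ZMod n) A := Module.Finite.of_finite
  ⟨(Module.finBasisOfFinrankEq (ZMod n) A h).equivFun⟩

theorem aux_addend {G : Type*} [Group G] (n : ℕ) [Fact n.Prime] (A : Type*) [AddCommGroup A]
    [Finite A] [Module (ZMod n) A] (h : Module.finrank (ZMod n) A = 2)
    (θ : G →* AddMonoid.End A) :
    ∃ ψ : G →* Module.End (ZMod n) (Fin 2 → ZMod n), ∀ g, ψ g = 1 → θ g = 1 := by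
  obtain ⟨e⟩ := aux_equiv n A h
  let t : G →* Module.End (ZMod n) A :=
    { toFun := fun g => AddMonoidHom.toZModLinearMap n (θ g)
      map_one' := by
        ext x
        rw [map_one]
        rfl
      map_mul' := by
        intro g h
        ext x
        rw [map_mul]
        rfl }
  let c : Module.End (ZMod n) A →* Module.End (ZMod n) (Fin 2 → ZMod n) :=
    (e.conjRingEquiv : _ →* _)
  refine ⟨c.comp t, fun g hg => ?_⟩
  have hg' : t g = 1 := (EmbeddingLike.map_eq_one_iff (f := e.conjRingEquiv)).1 hg
  ext x
  exact DFunLike.congr_fun hg' x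

theorem aux_elem {M G : Type*} [CommGroup M] [Finite M] [Group G] (n : ℕ) (hn : n.Prime)
    (hexp : ∀ m : M, m ^ n = 1) (hc : Nat.card M ≤ n ^ 2) (hnc : ¬ IsCyclic M)
    (θ : G →* Monoid.End M) :
    Nat.card M = n ^ 2 ∧ ∃ ψ : G →* Module.End (ZMod n) (Fin 2 → ZMod n),
      ∀ g, ψ g = 1 → θ g = 1 := by
  have : Fact n.Prime := ⟨hn⟩
  let _ : Module (ZMod n) (Additive M) := AddCommGroup.zmodModule (n := n) (fun x => by
    exact hexp x.toMul)
  have hfinM : Finite (Additive M) := inferInstanceAs (Finite M)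
  have hfd : Module.Finite (ZMod n) (Additive M) := Module.Finite.of_finite
  have hcardA : Nat.card (Additive M) = Nat.card M := rfl
  have hcard : Nat.card M = n ^ Module.finrank (ZMod n) (Additive M) := by
    rw [← hcardA]
    exact (FiniteField.pow_finrank_eq_natCard n (Additive M)).symm
  have hle : Module.finrank (ZMod n) (Additive M) ≤ 2 := by
    rw [hcard] at hc
    exact (Nat.pow_le_pow_iff_right hn.one_lt).1 hc
  have hfr : Module.finrank (ZMod n) (Additive M) = 2 := by
    interval_cases h : Module.finrank (ZMod n) (Additive M)
    · exfalso
      apply hnc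
      have := (Nat.card_eq_one_iff_unique.1 (by simpa using hcard)).1
      infer_instance
    · exfalso
      apply hnc
      exact isCyclic_of_prime_card (p := n) (by simpa using hcard)
    · rfl
  refine ⟨by rw [hcard, hfr], ?_⟩
  let t : G →* AddMonoid.End (Additive M) :=
    { toFun := fun g =>
        { toFun := fun x => Additive.ofMul (θ g x.toMul)
          map_zero' := map_one (θ g)
          map_add' := fun x y => map_mul (θ g) x.toMul y.toMul }
      map_one' := by rw [map_one]; rfl
      map_mul' := fun g h => by rw [map_mul]; rfl }
  have ht : ∀ g, t g = 1 → θ g = 1 := by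
    intro g hg
    ext m
    exact DFunLike.congr_fun hg (Additive.ofMul m)
  obtain ⟨ψ, hψ⟩ := aux_addend n (Additive M) hfr t
  exact ⟨ψ, fun g hg => ht g (hψ g hg)⟩

theorem aux_linInd {F V B M : Type*} [Field F] [AddCommGroup V] [Module F V] [Monoid B]
    (c d : B → Module.End F V) (χ : M → (B →* F)) (hχ : Function.Injective χ)
    (v : M → Module.End F V) (hv : ∀ m, v m ≠ 0)
    (h : ∀ b m, c b * v m * d b = χ m b • v m) : LinearIndependent F v := by
  rw [linearIndependent_iff']
  intro s g hg i hi
  have hli : LinearIndependent F (fun m => (χ m : B → F)) :=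
    (linearIndependent_monoidHom B F).comp χ hχ
  rw [linearIndependent_iff'] at hli
  have key : ∀ x : V, ∀ f : Module.Dual F V, g i * f (v i x) = 0 := by
    intro x f
    refine hli s (fun j => g j * f (v j x)) ?_ i hi
    funext b
    have h1 : c b * (∑ j ∈ s, g j • v j) * d b = 0 := by rw [hg]; simp
    rw [Finset.mul_sum, Finset.sum_mul] at h1
    have h2 : ∑ j ∈ s, g j • χ j b • v j = 0 := by
      rw [← h1]
      refine Finset.sum_congr rfl fun j _ => ?_
      rw [mul_smul_comm, smul_mul_assoc, h]
    have h3 := congrArg (fun l : Module.End F V => f (l x)) h2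
    simp only [LinearMap.sum_apply, LinearMap.smul_apply, map_sum, map_smul, smul_eq_mul,
      LinearMap.zero_apply, map_zero] at h3
    simp only [Finset.sum_apply, Pi.smul_apply, smul_eq_mul, Pi.zero_apply]
    rw [← h3]
    exact Finset.sum_congr rfl fun j _ => by ring
  by_contra hgi
  apply hv i
  ext x
  rw [LinearMap.zero_apply]
  rw [← Module.forall_dual_apply_eq_zero_iff F]
  intro f
  exact (mul_eq_zero.1 (key x f)).resolve_left hgi

theorem aux_case2 {F V G : Type*} [Field F] [AddCommGroup V] [Module F V] [Group G]
    [Group.IsSolvable G] (n : ℕ) (hn : n.Prime) (hV : Module.finrank F V = n)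
    (ρ : G →* Module.End F V) (hinj : Function.Injective ρ)
    (hab : ∀ A : Subgroup G, A.Normal → (∀ a ∈ A, ∀ b ∈ A, a * b = b * a) →
      ∀ a ∈ A, ∃ c : F, ρ a = algebraMap F _ c) :
    derivedSeries G 1 = ⊥ ∨ ∃ ψ : G →* Module.End (ZMod n) (Fin 2 → ZMod n),
      ∀ a b, ψ a = 1 → ψ b = 1 → ⁅a, b⁆ ∈ center G := by
  classical
  have hpos : 0 < Module.finrank F V := hV ▸ hn.pos
  have hfd : FiniteDimensional F V := Module.finite_of_finrank_pos hpos
  have hnt : Nontrivial V := Module.nontrivial_of_finrank_pos hpos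
  by_cases hZ : center G = ⊤
  · left
    rw [derivedSeries_succ, eq_bot_iff, Subgroup.commutator_le]
    intro a _ b _
    rw [mem_bot, commutatorElement_eq_one_iff_mul_comm]
    exact (mem_center_iff.1 (hZ ▸ mem_top a : a ∈ center G) b).symm
  right
  obtain ⟨k, hk1, hk2⟩ := aux_exists_last (center G) hZ
  generalize hB : derivedSeries G k = B at hk1
  have hBn : B.Normal := hB ▸ derivedSeries_normal G k
  have hBc : ∀ a ∈ B, ∀ b ∈ B, ⁅a, b⁆ ∈ center G := by
    intro a ha b hb
    subst hB
    exact hk2 (commutator_mem_commutator ha hb)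
  clear hk2 hB
  have hscal : ∀ z ∈ center G, ∃ c : F, ρ z = algebraMap F _ c :=
    hab (center G) inferInstance (fun a ha b _ => (mem_center_iff.1 ha b).symm)
  have hcen : ∀ g : G, (∀ x, ρ g * ρ x = ρ x * ρ g) → g ∈ center G := by
    intro g hg
    rw [mem_center_iff]
    intro x
    apply hinj
    rw [map_mul, map_mul, hg]
  have hscal' : ∀ g : G, (∃ c : F, ρ g = algebraMap F _ c) → g ∈ center G := by
    rintro g ⟨c, hc⟩
    apply hcen
    intro x
    rw [hc]
    exact Algebra.commutes _ _
  -- the center of `B`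
  have hZB : ∀ b ∈ B, (∀ x ∈ B, b * x = x * b) → b ∈ center G := by
    intro b hb hbx
    apply hscal'
    refine hab ((center B).map B.subtype) inferInstance ?_ b ?_
    · rintro _ ⟨a, ha, rfl⟩ _ ⟨c, hc, rfl⟩
      exact congrArg Subtype.val ((mem_center_iff.1 ha c).symm)
    · refine ⟨⟨b, hb⟩, ?_, rfl⟩
      rw [SetLike.mem_coe, mem_center_iff]
      intro x
      exact Subtype.ext (hbx x x.2).symm
  have hZB' : ∀ b : B, b ∈ center B ↔ (b : G) ∈ center G := by
    intro b
    constructor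
    · intro h
      exact hZB b b.2 fun x hx => congrArg Subtype.val (mem_center_iff.1 h ⟨x, hx⟩).symm
    · intro h
      rw [mem_center_iff]
      intro x
      exact Subtype.ext (mem_center_iff.1 h x)
  choose! sc hsc using hscal
  have hscinj : Function.Injective (algebraMap F (Module.End F V)) := (algebraMap F _).injective
  have hsc1 : ∀ z ∈ center G, sc z = 1 → z = 1 := by
    intro z hz h
    apply hinj
    rw [hsc z hz, h, map_one, map_one]
  have hunit : ∀ g : G, ρ g ≠ 0 := by
    intro g h
    have : ρ g * ρ g⁻¹ = 1 := by rw [← map_mul, mul_inv_cancel, map_one]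
    rw [h, zero_mul] at this
    exact zero_ne_one this
  have hcm : ∀ b ∈ B, ∀ c ∈ B, ∀ c' ∈ B, ⁅c * c', b⁆ = ⁅c, b⁆ * ⁅c', b⁆ := by
    intro b hb c hc c' hc'
    have h1 := mem_center_iff.1 (hBc c' hc' b hb)
    calc ⁅c * c', b⁆ = c * ⁅c', b⁆ * (b * c⁻¹ * b⁻¹) := by
          simp only [commutatorElement_def]; group
      _ = ⁅c', b⁆ * (c * (b * c⁻¹ * b⁻¹)) := by rw [h1 c, mul_assoc]
      _ = (c * (b * c⁻¹ * b⁻¹)) * ⁅c', b⁆ := (h1 _).symm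
      _ = ⁅c, b⁆ * ⁅c', b⁆ := by simp only [commutatorElement_def]; group
  let χ : B → (B →* F) := fun b =>
    { toFun := fun c => sc ⁅(c : G), (b : G)⁆
      map_one' := by
        apply hscinj
        rw [← hsc _ (hBc _ (1 : B).2 _ b.2)]
        simp
      map_mul' := fun c c' => by
        apply hscinj
        rw [map_mul, ← hsc _ (hBc _ (c * c').2 _ b.2), ← hsc _ (hBc _ c.2 _ b.2),
          ← hsc _ (hBc _ c'.2 _ b.2), ← map_mul, ← hcm b b.2 c c.2 c' c'.2]
        rfl }
  have hχ : ∀ b c : B, ρ c * ρ b * ρ (c : G)⁻¹ = χ b c • ρ b := by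
    intro b c
    have : (c : G) * b * (c : G)⁻¹ = ⁅(c : G), (b : G)⁆ * b := by
      simp [commutatorElement_def]
    rw [← map_mul, ← map_mul, this, map_mul, hsc _ (hBc _ c.2 _ b.2)]
    rw [Algebra.smul_def]
    rfl
  have hχeq : ∀ b b' : B, χ b = χ b' → b⁻¹ * b' ∈ center B := by
    intro b b' h
    rw [mem_center_iff]
    intro x
    have h1 := DFunLike.congr_fun h x
    have h2 : ⁅(x : G), (b : G)⁆ = ⁅(x : G), (b' : G)⁆ := by
      apply hinj
      rw [hsc _ (hBc _ x.2 _ b.2), hsc _ (hBc _ x.2 _ b'.2)]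
      exact congrArg _ h1
    have h3 : x * b * x⁻¹ * b⁻¹ = x * b' * x⁻¹ * b'⁻¹ := Subtype.ext h2
    have h4 : b * x⁻¹ * b⁻¹ = b' * x⁻¹ * b'⁻¹ := by
      simpa [mul_assoc] using h3
    have h5 : b * x * b⁻¹ = b' * x * b'⁻¹ := by
      have := congrArg (fun t => t⁻¹) h4
      simpa [mul_assoc] using this
    calc x * (b⁻¹ * b') = b⁻¹ * (b * x * b⁻¹) * b' := by group
      _ = b⁻¹ * b' * x := by rw [h5]; group
  have hpow : ∀ b : B, b ^ n ∈ center B := by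
    intro b
    rw [mem_center_iff]
    intro c
    have hz := hBc c c.2 b b.2
    set z := ⁅(c : G), (b : G)⁆ with hzdef
    have hconj : (c : G) * b * (c : G)⁻¹ = z * b := by
      simp [hzdef, commutatorElement_def]
    have hdet : LinearMap.det (ρ ((c : G) * b * (c : G)⁻¹)) = LinearMap.det (ρ (z * b)) := by
      rw [hconj]
    have hdetb : LinearMap.det (ρ (b : G)) ≠ 0 := by
      intro h0
      have : LinearMap.det (ρ ((b : G) * (b : G)⁻¹)) = 1 := by simp
      rw [map_mul, map_mul, h0, zero_mul] at this
      exact zero_ne_one this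
    have hzn : z ^ n = 1 := by
      have e1 : LinearMap.det (ρ ((c : G) * b * (c : G)⁻¹)) = LinearMap.det (ρ (b : G)) := by
        have : LinearMap.det (ρ ((c : G) * (c : G)⁻¹)) = 1 := by simp
        rw [map_mul, map_mul] at this
        rw [map_mul, map_mul, map_mul, map_mul, mul_right_comm, this, one_mul]
      have e2 : LinearMap.det (ρ (z * b)) = sc z ^ n * LinearMap.det (ρ (b : G)) := by
        rw [map_mul, hsc z hz, ← Algebra.smul_def, LinearMap.det_smul, hV]
      have e3 : sc z ^ n = 1 := by
        rw [e1, e2] at hdet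
        exact (mul_eq_right₀ hdetb).1 hdet.symm
      apply hinj
      rw [map_pow, hsc z hz, ← map_pow, e3, map_one, map_one]
    apply Subtype.ext
    have hcz : Commute z (b : G) := (mem_center_iff.1 hz b).symm
    have : (c : G) * (b : G) ^ n * (c : G)⁻¹ = (b : G) ^ n := by
      rw [← conj_pow, hconj, hcz.mul_pow, hzn, one_mul]
    exact mul_inv_eq_iff_eq_mul.1 this
  -- the quotient
  have hqcomm : ∀ a b : B ⧸ center B, a * b = b * a := by
    intro a b
    induction a using QuotientGroup.induction_on with | _ a
    induction b using QuotientGroup.induction_on with | _ b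
    rw [← QuotientGroup.mk_mul, ← QuotientGroup.mk_mul, QuotientGroup.eq, hZB']
    have := hBc (b : G)⁻¹ (inv_mem b.2) (a : G)⁻¹ (inv_mem a.2)
    simpa [commutatorElement_def, mul_assoc] using this
  let _ : CommGroup (B ⧸ center B) :=
    { (inferInstance : Group (B ⧸ center B)) with mul_comm := hqcomm }
  let v : B ⧸ center B → Module.End F V := fun m => ρ (m.out : B)
  have hli : LinearIndependent F v := by
    refine aux_linInd (B := B) (fun c => ρ c) (fun c => ρ (c : G)⁻¹) (fun m => χ m.out) ?_ v
      (fun m => hunit _) (fun b m => hχ _ _)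
    intro m m' h
    have := hχeq _ _ h
    rw [← QuotientGroup.eq] at this
    simpa using this
  have hfin : Finite (B ⧸ center B) := hli.finite
  have hfe : Module.finrank F (Module.End F V) = n ^ 2 := by
    rw [Module.finrank_linearMap, hV, sq]
  have hcard : Nat.card (B ⧸ center B) ≤ n ^ 2 := by
    have := Fintype.ofFinite (B ⧸ center B)
    rw [Nat.card_eq_fintype_card, ← hfe]
    exact hli.fintype_card_le_finrank
  have hnc : ¬ IsCyclic (B ⧸ center B) := by
    intro hcyc
    apply hk1
    intro b hb
    refine hZB b hb fun x hx => ?_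
    have hmc := MonoidHom.isMulCommutative_of_isCyclic_of_ker_le_center
      (QuotientGroup.mk' (center B)) (by simp)
    have := hmc.is_comm.comm (⟨b, hb⟩ : B) ⟨x, hx⟩
    exact congrArg Subtype.val this
  have hqexp : ∀ m : B ⧸ center B, m ^ n = 1 := by
    intro m
    induction m using QuotientGroup.induction_on with | _ b
    rw [← QuotientGroup.mk_pow]
    exact (QuotientGroup.eq_one_iff _).2 (hpow b)
  let θ : G →* Monoid.End (B ⧸ center B) :=
    { toFun := fun g => QuotientGroup.map (center B) (center B)
        ((MulAut.conjNormal g : B ≃* B) : B →* B) (by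
          intro b hb
          rw [mem_comap, hZB']
          rw [hZB'] at hb
          simpa using (inferInstance : (center G).Normal).conj_mem _ hb g)
      map_one' := by
        ext b
        induction b using QuotientGroup.induction_on with | _ b
        change QuotientGroup.mk (MulAut.conjNormal (1 : G) b) = QuotientGroup.mk b
        simp
      map_mul' := by
        intro g h
        ext b
        induction b using QuotientGroup.induction_on with | _ b
        change QuotientGroup.mk (MulAut.conjNormal (g * h) b) =
          QuotientGroup.mk (MulAut.conjNormal g (MulAut.conjNormal h b))
        rw [map_mul, MulAut.mul_apply] }
  obtain ⟨hcardeq, ψ, hψ⟩ := aux_elem n hn hqexp hcard hnc θ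
  have hspan : Submodule.span F (Set.range v) = ⊤ := by
    have := Fintype.ofFinite (B ⧸ center B)
    have := Fintype.ofFinite (B ⧸ center B)
    apply hli.span_eq_top_of_card_eq_finrank'
    rw [← Nat.card_eq_fintype_card, hcardeq, hfe]
  have hcB : ∀ g : G, (∀ b ∈ B, g * b = b * g) → g ∈ center G := by
    intro g hg
    apply hcen
    intro x
    generalize ρ x = t
    have : t ∈ Submodule.span F (Set.range v) := hspan ▸ Submodule.mem_top
    induction this using Submodule.span_induction with
    | mem y hy =>
      obtain ⟨m, rfl⟩ := hy
      change ρ g * ρ _ = ρ _ * ρ g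
      rw [← map_mul, hg _ (Subtype.mem _), map_mul]
    | zero => simp
    | add y z _ _ hy hz => rw [mul_add, add_mul, hy, hz]
    | smul c y _ hy => rw [mul_smul_comm, smul_mul_assoc, hy]
  have hθ : ∀ g, ψ g = 1 → ∀ b ∈ B, ∃ z ∈ center G, g * b * g⁻¹ = z * b := by
    intro g hg b hb
    have h1 := DFunLike.congr_fun (hψ g hg) (QuotientGroup.mk (⟨b, hb⟩ : B))
    have h2 : (QuotientGroup.mk (MulAut.conjNormal g (⟨b, hb⟩ : B)) : B ⧸ center B)
      = QuotientGroup.mk (⟨b, hb⟩ : B) := h1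
    have h3 := (hZB' _).1 (QuotientGroup.eq.1 h2.symm)
    refine ⟨_, h3, ?_⟩
    rw [← mem_center_iff.1 h3 b]
    simp
  refine ⟨ψ, fun a b ha hb => hcB _ fun x hx => ?_⟩
  have key : ∀ y ∈ B, a * b * y * (a * b)⁻¹ = b * a * y * (b * a)⁻¹ := by
    intro y hy
    obtain ⟨z, hz, hz'⟩ := hθ a ha y hy
    obtain ⟨w, hw, hw'⟩ := hθ b hb y hy
    have hz1 := mem_center_iff.1 hz
    have hw1 := mem_center_iff.1 hw
    calc a * b * y * (a * b)⁻¹ = a * (b * y * b⁻¹) * a⁻¹ := by group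
      _ = w * (a * y * a⁻¹) := by rw [hw', ← mul_assoc, hw1 a]; group
      _ = z * (w * y) := by rw [hz', ← mul_assoc, hz1 w, mul_assoc]
      _ = z * (b * y * b⁻¹) := by rw [hw']
      _ = b * (z * y) * b⁻¹ := by rw [← mul_assoc b z, hz1 b]; group
      _ = b * a * y * (b * a)⁻¹ := by rw [← hz']; group
  have hx' := key ((b * a)⁻¹ * x * (b * a)) (by simpa using hBn.conj_mem x hx (b * a)⁻¹)
  have e : ⁅a, b⁆ * x * ⁅a, b⁆⁻¹ = x := by
    calc ⁅a, b⁆ * x * ⁅a, b⁆⁻¹ = a * b * ((b * a)⁻¹ * x * (b * a)) * (a * b)⁻¹ := by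
          simp [commutatorElement_def, mul_assoc]
      _ = x := by rw [hx']; group
  exact mul_inv_eq_iff_eq_mul.1 e

theorem aux_D3_of_D2 {G : Type*} [Group G] (k : ℕ) (h : ∀ a ∈ derivedSeries G k,
    ∀ b ∈ derivedSeries G k, a * b = b * a) : derivedSeries G (k + 1) = ⊥ := by
  rw [derivedSeries_succ, eq_bot_iff, Subgroup.commutator_le]
  intro a ha b hb
  rw [mem_bot, commutatorElement_eq_one_iff_mul_comm]
  exact h a ha b hb

theorem aux_field {F V G E : Type*} [Field F] [AddCommGroup V] [Module F V] [Group G]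
    (n : ℕ) (hn : n.Prime) (hV : Module.finrank F V = n)
    (ρ : G →* Module.End F V) (hinj : Function.Injective ρ)
    [Field E] [Algebra F E] [Module.Finite F E] [Module E V] [IsScalarTower F E V]
    (σ : G →* (E ≃ₐ[F] E)) (hσ : ∀ g (x : E) v, ρ g (x • v) = σ g x • ρ g v)
    (hns : ∃ x : E, x ∉ Set.range (algebraMap F E)) :
    derivedSeries G 2 = ⊥ := by
  have hmul : Module.finrank F E * Module.finrank E V = n := by
    rw [Module.finrank_mul_finrank, hV]
  have hne : Module.finrank F E ≠ 1 := by
    intro h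
    obtain ⟨x, hx⟩ := hns
    apply hx
    have h1 := (finrank_eq_one_iff_of_nonzero' (1 : E) one_ne_zero).1 h x
    obtain ⟨c, hc⟩ := h1
    exact ⟨c, by rw [Algebra.algebraMap_eq_smul_one, hc]⟩
  have hFE : Module.finrank F E = n :=
    ((Nat.dvd_prime hn).1 (Dvd.intro _ hmul)).resolve_left hne
  have hEV : Module.finrank E V = 1 := by
    rw [hFE] at hmul
    exact Nat.eq_of_mul_eq_mul_left hn.pos (by rw [hmul, mul_one])
  have hcard : Nat.card (E ≃ₐ[F] E) ∣ n := by
    have h1 := IntermediateField.finrank_fixedField_eq_card (⊤ : Subgroup (E ≃ₐ[F] E))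
    rw [Subgroup.card_top] at h1
    rw [← h1, ← hFE]
    exact Dvd.intro_left _ (Module.finrank_mul_finrank F
      (IntermediateField.fixedField (⊤ : Subgroup (E ≃ₐ[F] E))) E)
  have hcyc : IsCyclic (E ≃ₐ[F] E) := by
    have : Fact n.Prime := ⟨hn⟩
    rcases (Nat.dvd_prime hn).1 hcard with h | h
    · have := (Nat.card_eq_one_iff_unique.1 h).1
      infer_instance
    · exact isCyclic_of_prime_card h
  have hcomm : ∀ s t : E ≃ₐ[F] E, s * t = t * s := by
    intro s t
    obtain ⟨z, hz⟩ := hcyc.exists_generator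
    obtain ⟨i, rfl⟩ := mem_zpowers_iff.1 (hz s)
    obtain ⟨j, rfl⟩ := mem_zpowers_iff.1 (hz t)
    rw [← _root_.zpow_add, ← _root_.zpow_add, add_comm]
  have hD1 : ∀ a ∈ derivedSeries G 1, σ a = 1 := by
    have : derivedSeries G 1 ≤ σ.ker := by
      rw [derivedSeries_succ, Subgroup.commutator_le]
      intro a _ b _
      rw [MonoidHom.mem_ker, map_commutatorElement, commutatorElement_eq_one_iff_mul_comm]
      exact hcomm _ _
    exact fun a ha => this ha
  apply aux_D3_of_D2
  intro a ha b hb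
  apply hinj
  obtain ⟨v, hv, hgen⟩ := finrank_eq_one_iff'.1 hEV
  obtain ⟨x, hx⟩ := hgen (ρ a v)
  obtain ⟨y, hy⟩ := hgen (ρ b v)
  ext w
  obtain ⟨c, rfl⟩ := hgen w
  simp only [map_mul, Module.End.mul_apply, hσ, ← hx, ← hy, hD1 a ha, hD1 b hb,
    AlgEquiv.one_apply]
  rw [smul_comm x y]

theorem aux_case1 {F V G E : Type*} [Field F] [AddCommGroup V] [Module F V] [Group G]
    [Group.IsSolvable G] (n : ℕ) (hn : n.Prime) (hV : Module.finrank F V = n)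
    (ρ : G →* Module.End F V) (hinj : Function.Injective ρ)
    (hirr : ∀ W : Submodule F V, (∀ g, W.map (ρ g) ≤ W) → W = ⊥ ∨ W = ⊤)
    [CommRing E] [Algebra F E] [Module.Finite F E] [Module E V] [IsScalarTower F E V]
    [FaithfulSMul E V]
    (σ : G →* (E ≃ₐ[F] E)) (hσ : ∀ g (x : E) v, ρ g (x • v) = σ g x • ρ g v)
    (hns : ∃ x : E, x ∉ Set.range (algebraMap F E)) :
    derivedSeries G 3 = ⊥ := by
  classical
  have hpos : 0 < Module.finrank F V := hV ▸ hn.pos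
  have hfd : FiniteDimensional F V := Module.finite_of_finrank_pos hpos
  have hnt : Nontrivial V := Module.nontrivial_of_finrank_pos hpos
  have hart : IsArtinianRing E := IsArtinianRing.of_finite F E
  have hρinv : ∀ g v, ρ g (ρ g⁻¹ v) = v := by
    intro g v
    rw [← Module.End.mul_apply, ← map_mul, mul_inv_cancel, map_one, Module.End.one_apply]
  have hρinj : ∀ g, Function.Injective (ρ g) := by
    intro g
    apply Function.LeftInverse.injective (g := ρ g⁻¹)
    intro v
    have := hρinv g⁻¹ v
    rwa [inv_inv] at this
  -- the components
  let T : MaximalSpectrum E → Submodule F V := fun m =>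
    (Submodule.torsionBySet E V (m.asIdeal : Set E)).restrictScalars F
  have hT : ∀ m v, v ∈ T m ↔ ∀ x ∈ m.asIdeal, x • v = 0 := by
    intro m v
    simp only [T, Submodule.restrictScalars_mem, Submodule.mem_torsionBySet_iff]
    exact ⟨fun h x hx => h ⟨x, hx⟩, fun h x => h x x.2⟩
  have hind : iSupIndep T := by
    have := Fintype.ofFinite (MaximalSpectrum E)
    have h1 : (Finset.univ : Finset (MaximalSpectrum E)).SupIndep
        fun m => Submodule.torsionBySet E V (m.asIdeal : Set E) := by
      apply Submodule.supIndep_torsionBySet_ideal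
      intro m _ m' _ hmm
      exact Ideal.isCoprime_iff_sup_eq.1
        (Ideal.isCoprime_of_isMaximal fun h => hmm (MaximalSpectrum.ext h))
    have h2 := iSupIndep_iff_supIndep_univ.2 h1
    intro m
    have h3 := h2 m
    rw [disjoint_iff] at h3 ⊢
    have h4 := congrArg (Submodule.restrictScalarsLatticeHom F E V) h3
    simp only [InfHomClass.map_inf, _root_.map_iSup, BotHomClass.map_bot] at h4
    exact h4
  obtain ⟨m0, hm0⟩ : ∃ m, T m ≠ ⊥ := by
    obtain ⟨P, hP⟩ := associatedPrimes.nonempty E V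
    obtain ⟨hPp, v, hv⟩ := Submodule.isAssociatedPrime_iff.1 hP
    have hmax : P.IsMaximal := inferInstance
    refine ⟨⟨P, hmax⟩, ?_⟩
    rw [Submodule.ne_bot_iff]
    refine ⟨v, ?_, ?_⟩
    · rw [hT]
      intro x hx
      change x ∈ P at hx
      rw [hv, Submodule.mem_colon_singleton] at hx
      simpa using hx
    · rintro rfl
      apply hPp.ne_top
      rw [hv, Ideal.eq_top_iff_one, Submodule.mem_colon_singleton]
      simp
  let _ : MulAction G (MaximalSpectrum E) :=
    { smul := fun g m => ⟨m.asIdeal.comap (σ g⁻¹), Ideal.comap_isMaximal_of_equiv _⟩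
      one_smul := by
        intro m
        apply MaximalSpectrum.ext
        change m.asIdeal.comap (σ 1⁻¹) = m.asIdeal
        ext x
        simp
      mul_smul := by
        intro g h m
        apply MaximalSpectrum.ext
        change m.asIdeal.comap (σ (g * h)⁻¹) = (m.asIdeal.comap (σ h⁻¹)).comap (σ g⁻¹)
        ext x
        simp [Ideal.mem_comap, _root_.mul_inv_rev, AlgEquiv.mul_apply] }
  have hsm : ∀ (g : G) (m : MaximalSpectrum E) x, x ∈ (g • m).asIdeal ↔ σ g⁻¹ x ∈ m.asIdeal :=
    fun g m x => Iff.rfl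
  have hTle : ∀ g m, (T m).map (ρ g) ≤ T (g • m) := by
    rintro g m _ ⟨v, hv, rfl⟩
    rw [hT]
    intro x hx
    rw [hsm] at hx
    have h1 := hσ g (σ g⁻¹ x) v
    rw [(hT m v).1 hv _ hx, map_zero, ← AlgEquiv.mul_apply, ← map_mul, mul_inv_cancel, map_one,
      AlgEquiv.one_apply] at h1
    exact h1.symm
  have hTeq : ∀ g m, (T m).map (ρ g) = T (g • m) := by
    intro g m
    refine le_antisymm (hTle g m) ?_
    intro v hv
    refine ⟨ρ g⁻¹ v, ?_, hρinv g v⟩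
    have := hTle g⁻¹ (g • m) ⟨v, hv, rfl⟩
    rwa [inv_smul_smul] at this
  let X := MulAction.orbit G m0
  have hXfin : Fintype X := Fintype.ofFinite X
  have hU : ⨆ x : X, T x = ⊤ := by
    have := hirr (⨆ x : X, T x) ?_
    · refine this.resolve_left fun h => hm0 ?_
      rw [eq_bot_iff, ← h]
      exact le_iSup (fun x : X => T x) ⟨m0, MulAction.mem_orbit_self m0⟩
    · intro g
      rw [Submodule.map_iSup]
      refine iSup_le fun x => ?_
      rw [hTeq]
      exact le_iSup (fun x : X => T x) (g • x)
  have hind' : iSupIndep (fun x : X => T x) := hind.comp Subtype.val_injective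
  have hfr : ∀ x : X, Module.finrank F (T x) = Module.finrank F (T m0) := by
    rintro ⟨_, g, rfl⟩
    change Module.finrank F (T (g • m0)) = _
    rw [← hTeq]
    exact (LinearEquiv.finrank_eq (Submodule.equivMapOfInjective (ρ g) (hρinj g) (T m0))).symm
  have hdim : Nat.card X * Module.finrank F (T m0) = n := by
    have hint := DirectSum.isInternal_submodule_of_iSupIndep_of_iSup_eq_top hind' hU
    have e := LinearEquiv.ofBijective (DirectSum.coeLinearMap fun x : X => T x) hint
    rw [← hV, ← e.finrank_eq, Module.finrank_directSum, Finset.sum_congr rfl fun x _ => hfr x]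
    simp
  rcases (Nat.dvd_prime hn).1 (Dvd.intro _ hdim) with h1 | h1
  · -- one component
    have hsub := (Nat.card_eq_one_iff_unique.1 h1).1
    have hTtop : T m0 = ⊤ := by
      rw [eq_top_iff, ← hU]
      refine iSup_le fun x => ?_
      rw [Subsingleton.elim x ⟨m0, MulAction.mem_orbit_self m0⟩]
    have hbot : m0.asIdeal = ⊥ := by
      rw [eq_bot_iff]
      intro x hx
      rw [Ideal.mem_bot]
      apply FaithfulSMul.eq_of_smul_eq_smul (α := V)
      intro v
      rw [zero_smul]
      exact (hT m0 v).1 (hTtop ▸ Submodule.mem_top) x hx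
    have hEnt : Nontrivial E := by
      obtain ⟨x, hx⟩ := hns
      refine ⟨x, algebraMap F E 0, fun h => hx ⟨0, h.symm⟩⟩
    have hunit : ∀ x : E, IsUnit x ∨ x = 0 := by
      intro x
      by_cases hx : x = 0
      · exact Or.inr hx
      · left
        have hmax := m0.isMaximal
        rw [hbot] at hmax
        obtain ⟨y, hy⟩ := hmax.exists_inv (x := x) (by simpa using hx)
        obtain ⟨i, hi, hyi⟩ := hy
        rw [Ideal.mem_bot] at hi
        rw [hi, add_zero] at hyi
        exact IsUnit.of_mul_eq_one_right _ hyi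
    let _ : Field E := Field.ofIsUnitOrEqZero hunit
    have h2 := aux_field n hn hV ρ hinj σ hσ hns
    rw [eq_bot_iff, ← h2]
    exact derivedSeries_antitone G (by norm_num)
  · -- `n` components
    have hT1 : Module.finrank F (T m0) = 1 := by
      rw [h1] at hdim
      exact Nat.eq_of_mul_eq_mul_left hn.pos (by rw [hdim, mul_one])
    have hperm := aux_perm (G := G) (X := X) (by rw [h1]; exact hn)
    apply aux_D3_of_D2 2
    intro a ha b hb
    apply hinj
    have hscal : ∀ a ∈ derivedSeries G 2, ∀ x : X, ∀ v ∈ T x, ρ a v ∈ T x := by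
      intro a ha x v hv
      have h2 := hTle a x ⟨v, hv, rfl⟩
      have h3 : a • (x : MaximalSpectrum E) = x := congrArg Subtype.val (hperm a ha x)
      rwa [h3] at h2
    have hle : (⊤ : Submodule F V) ≤ LinearMap.eqLocus (ρ (a * b)) (ρ (b * a)) := by
      rw [← hU]
      refine iSup_le fun x => ?_
      obtain ⟨⟨v, hv⟩, hv0, hgen⟩ := finrank_eq_one_iff'.1 ((hfr x).trans hT1)
      have hgen' : ∀ w ∈ T x, ∃ c : F, c • v = w := by
        intro w hw
        obtain ⟨c, hc⟩ := hgen ⟨w, hw⟩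
        exact ⟨c, congrArg Subtype.val hc⟩
      intro w hw
      obtain ⟨c, rfl⟩ := hgen' w hw
      obtain ⟨s, hs⟩ := hgen' _ (hscal a ha x v hv)
      obtain ⟨t, ht⟩ := hgen' _ (hscal b hb x v hv)
      rw [LinearMap.mem_eqLocus]
      simp only [map_mul, Module.End.mul_apply, map_smul, ← hs, ← ht]
      rw [smul_comm s t]
    ext v
    exact hle Submodule.mem_top

theorem aux_main {F V G : Type*} [Field F] [AddCommGroup V] [Module F V] [Group G]
    [Group.IsSolvable G] (n : ℕ) (hn : n.Prime) (hV : Module.finrank F V = n)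
    (ρ : G →* Module.End F V) (hinj : Function.Injective ρ)
    (hirr : ∀ W : Submodule F V, (∀ g, W.map (ρ g) ≤ W) → W = ⊥ ∨ W = ⊤) :
    derivedSeries G 3 = ⊥ ∨ ∃ ψ : G →* Module.End (ZMod n) (Fin 2 → ZMod n),
      ∀ a b, ψ a = 1 → ψ b = 1 → ⁅a, b⁆ ∈ center G := by
  by_cases hab : ∀ A : Subgroup G, A.Normal → (∀ a ∈ A, ∀ b ∈ A, a * b = b * a) →
      ∀ a ∈ A, ∃ c : F, ρ a = algebraMap F _ c
  · rcases aux_case2 n hn hV ρ hinj hab with h | h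
    · left
      rw [eq_bot_iff, ← h]
      exact derivedSeries_antitone G (by norm_num)
    · exact Or.inr h
  left
  push Not at hab
  obtain ⟨A, hAn, hAc, a, ha, hns⟩ := hab
  have hpos : 0 < Module.finrank F V := hV ▸ hn.pos
  have hfd : FiniteDimensional F V := Module.finite_of_finrank_pos hpos
  let E : Subalgebra F (Module.End F V) := Algebra.adjoin F (ρ '' (A : Set G))
  have hcomm : ∀ x ∈ ρ '' (A : Set G), ∀ y ∈ ρ '' (A : Set G), x * y = y * x := by
    rintro _ ⟨x, hx, rfl⟩ _ ⟨y, hy, rfl⟩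
    rw [← map_mul, ← map_mul, hAc x hx y hy]
  let _ : CommRing E := Algebra.adjoinCommRingOfComm F hcomm
  have hinv : ∀ g : G, ρ g⁻¹ * ρ g = 1 := by
    intro g
    rw [← map_mul, inv_mul_cancel, map_one]
  have hinv' : ∀ g : G, ρ g * ρ g⁻¹ = 1 := by
    intro g
    rw [← map_mul, mul_inv_cancel, map_one]
  have hmem : ∀ g : G, ∀ x ∈ E, ρ g * x * ρ g⁻¹ ∈ E := by
    intro g x hx
    induction hx using Algebra.adjoin_induction with
    | mem x hx =>
      obtain ⟨b, hb, rfl⟩ := hx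
      rw [← map_mul, ← map_mul]
      exact Algebra.subset_adjoin ⟨_, hAn.conj_mem b hb g, rfl⟩
    | algebraMap r =>
      rw [← Algebra.commutes, mul_assoc, hinv', mul_one]
      exact E.algebraMap_mem r
    | add x y _ _ hx hy =>
      rw [mul_add, add_mul]
      exact E.add_mem hx hy
    | mul x y _ _ hx hy =>
      have : ρ g * (x * y) * ρ g⁻¹ = (ρ g * x * ρ g⁻¹) * (ρ g * y * ρ g⁻¹) := by
        calc ρ g * (x * y) * ρ g⁻¹ = ρ g * x * 1 * y * ρ g⁻¹ := by
              simp only [mul_assoc, mul_one, one_mul]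
          _ = _ := by rw [← hinv g]; simp only [mul_assoc]
      rw [this]
      exact E.mul_mem hx hy
  have hconjmul : ∀ (g : G) (x y : Module.End F V),
      ρ g * (x * y) * ρ g⁻¹ = (ρ g * x * ρ g⁻¹) * (ρ g * y * ρ g⁻¹) := by
    intro g x y
    calc ρ g * (x * y) * ρ g⁻¹ = ρ g * x * 1 * y * ρ g⁻¹ := by
          simp only [mul_assoc, mul_one, one_mul]
      _ = _ := by rw [← hinv g]; simp only [mul_assoc]
  let τ : G → (E →ₐ[F] E) := fun g =>
    { toFun := fun x => ⟨ρ g * x * ρ g⁻¹, hmem g x x.2⟩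
      map_one' := Subtype.ext (by
        change ρ g * 1 * ρ g⁻¹ = 1
        rw [mul_one, hinv'])
      map_mul' := fun x y => Subtype.ext (hconjmul g x y)
      map_zero' := Subtype.ext (by
        change ρ g * 0 * ρ g⁻¹ = 0
        simp)
      map_add' := fun x y => Subtype.ext (by
        change ρ g * (x.1 + y.1) * ρ g⁻¹ = ρ g * x.1 * ρ g⁻¹ + ρ g * y.1 * ρ g⁻¹
        rw [mul_add, add_mul])
      commutes' := fun r => Subtype.ext (by
        change ρ g * (algebraMap F (Module.End F V) r) * ρ g⁻¹ = algebraMap F (Module.End F V) r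
        rw [← Algebra.commutes, mul_assoc, hinv', mul_one]) }
  have hτ1 : τ 1 = AlgHom.id F E := by
    apply AlgHom.ext
    intro x
    apply Subtype.ext
    change ρ 1 * x.1 * ρ 1⁻¹ = x.1
    rw [inv_one, map_one, one_mul, mul_one]
  have hτm : ∀ g h, τ (g * h) = (τ g).comp (τ h) := by
    intro g h
    apply AlgHom.ext
    intro x
    apply Subtype.ext
    change ρ (g * h) * x.1 * ρ (g * h)⁻¹ = ρ g * (ρ h * x.1 * ρ h⁻¹) * ρ g⁻¹
    rw [_root_.mul_inv_rev, map_mul, map_mul]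
    simp only [mul_assoc]
  let σ : G →* (E ≃ₐ[F] E) :=
    { toFun := fun g => AlgEquiv.ofAlgHom (τ g) (τ g⁻¹)
        (by rw [← hτm, mul_inv_cancel, hτ1]) (by rw [← hτm, inv_mul_cancel, hτ1])
      map_one' := by
        apply AlgEquiv.ext
        intro x
        exact DFunLike.congr_fun hτ1 x
      map_mul' := by
        intro g h
        apply AlgEquiv.ext
        intro x
        exact DFunLike.congr_fun (hτm g h) x }
  have hEfin : Module.Finite F E := by
    exact FiniteDimensional.finiteDimensional_submodule (Subalgebra.toSubmodule E)
  refine aux_case1 n hn hV ρ hinj hirr σ ?_ ?_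
  · intro g x v
    change ρ g (x.1 v) = (ρ g * x.1 * ρ g⁻¹) (ρ g v)
    rw [← Module.End.mul_apply, ← Module.End.mul_apply, mul_assoc _ (ρ g⁻¹), hinv, mul_one]
  · refine ⟨⟨ρ a, Algebra.subset_adjoin ⟨a, ha, rfl⟩⟩, ?_⟩
    rintro ⟨c, hc⟩
    exact hns c (congrArg Subtype.val hc).symm

theorem aux_D1_le_ker {G N : Type*} [Group G] [Monoid N] (f : G →* N)
    (h : ∀ a b, f a * f b = f b * f a) : derivedSeries G 1 ≤ f.ker := by
  rw [derivedSeries_succ, Subgroup.commutator_le]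
  intro a _ b _
  rw [MonoidHom.mem_ker, commutatorElement_def, map_mul, map_mul, map_mul, h a b, mul_assoc (f b),
    ← map_mul f a, mul_inv_cancel, map_one, mul_one, ← map_mul, mul_inv_cancel, map_one]

theorem aux_end_comm {F V : Type*} [Field F] [AddCommGroup V] [Module F V]
    (h : Module.finrank F V = 1) (a b : Module.End F V) : a * b = b * a := by
  obtain ⟨v, hv, hgen⟩ := finrank_eq_one_iff'.1 h
  obtain ⟨s, hs⟩ := hgen (a v)
  obtain ⟨t, ht⟩ := hgen (b v)
  ext w
  obtain ⟨c, rfl⟩ := hgen w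
  simp only [Module.End.mul_apply, map_smul, ← hs, ← ht]
  rw [smul_comm s t]

theorem aux_central {G N : Type*} [Group G] [Monoid N] (ψ : G →* N) (k : ℕ)
    (hk : derivedSeries G k ≤ ψ.ker)
    (h : ∀ a b, ψ a = 1 → ψ b = 1 → ⁅a, b⁆ ∈ center G) : derivedSeries G (k + 2) = ⊥ := by
  apply aux_D3_of_D2 (k + 1)
  have hc : derivedSeries G (k + 1) ≤ center G := by
    rw [derivedSeries_succ, Subgroup.commutator_le]
    intro a ha b hb
    exact h a b (hk ha) (hk hb)
  intro a ha b _
  exact (mem_center_iff.1 (hc ha) b).symm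

theorem aux_gl22 {G : Type*} [Group G] (ψ : G →* Module.End (ZMod 2) (Fin 2 → ZMod 2)) :
    derivedSeries G 2 ≤ ψ.ker := by
  let X := {x : Fin 2 → ZMod 2 // x ≠ 0}
  have hinv : ∀ g v, ψ g⁻¹ (ψ g v) = v := by
    intro g v
    rw [← Module.End.mul_apply, ← map_mul, inv_mul_cancel, map_one, Module.End.one_apply]
  let _ : MulAction G X :=
    { smul := fun g x => ⟨ψ g x.1, fun h => x.2 (by rw [← hinv g x.1, h, map_zero])⟩
      one_smul := fun x => Subtype.ext (by
        change ψ 1 x.1 = x.1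
        rw [map_one, Module.End.one_apply])
      mul_smul := fun g h x => Subtype.ext (by
        change ψ (g * h) x.1 = ψ g (ψ h x.1)
        rw [map_mul, Module.End.mul_apply]) }
  have hX : Nat.card X = 3 := by
    rw [Nat.card_eq_fintype_card]
    decide +kernel
  intro g hg
  have h1 := aux_derivedSeries_map_mem (MulAction.toPermHom G X) 2 hg
  rw [aux_s3 hX, mem_bot] at h1
  rw [MonoidHom.mem_ker]
  apply LinearMap.ext
  intro x
  by_cases hx : x = 0
  · rw [hx, map_zero, map_zero]
  · exact congrArg Subtype.val (DFunLike.congr_fun h1 (⟨x, hx⟩ : X))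

theorem aux_deg2 {F V G : Type*} [Field F] [AddCommGroup V] [Module F V] [Group G]
    [Group.IsSolvable G] (hV : Module.finrank F V = 2)
    (ρ : G →* Module.End F V) (hinj : Function.Injective ρ) :
    derivedSeries G 4 = ⊥ := by
  have hpos : 0 < Module.finrank F V := by omega
  have hfd : FiniteDimensional F V := Module.finite_of_finrank_pos hpos
  by_cases hirr : ∀ W : Submodule F V, (∀ g, W.map (ρ g) ≤ W) → W = ⊥ ∨ W = ⊤
  · rcases aux_main 2 Nat.prime_two hV ρ hinj hirr with h | ⟨ψ, hψ⟩
    · rw [eq_bot_iff, ← h]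
      exact derivedSeries_antitone G (by norm_num)
    · exact aux_central ψ 2 (aux_gl22 ψ) hψ
  · push Not at hirr
    obtain ⟨W, hW, hWb, hWt⟩ := hirr
    have h1 : Module.finrank F W ≠ 0 := fun h => hWb (Submodule.finrank_eq_zero.1 h)
    have h2 : Module.finrank F W < 2 := by
      rw [← hV]
      exact Submodule.finrank_lt hWt
    have h3 := Submodule.finrank_quotient_add_finrank W
    have hW1 : Module.finrank F W = 1 := by omega
    have hQ1 : Module.finrank F (V ⧸ W) = 1 := by omega
    have hW' : ∀ g, ∀ w ∈ W, ρ g w ∈ W := fun g w hw => hW g ⟨w, hw, rfl⟩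
    let f1 : G →* Module.End F W :=
      { toFun := fun g => (ρ g).restrict (hW' g)
        map_one' := by
          ext w
          change ρ 1 w.1 = w.1
          rw [map_one, Module.End.one_apply]
        map_mul' := by
          intro g h
          ext w
          change ρ (g * h) w.1 = ρ g (ρ h w.1)
          rw [map_mul, Module.End.mul_apply] }
    let f2 : G →* Module.End F (V ⧸ W) :=
      { toFun := fun g => W.mapQ W (ρ g) (hW' g)
        map_one' := by
          apply LinearMap.ext
          intro q
          obtain ⟨v, rfl⟩ := Submodule.mkQ_surjective W q
          change W.mkQ (ρ 1 v) = W.mkQ v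
          rw [map_one, Module.End.one_apply]
        map_mul' := by
          intro g h
          apply LinearMap.ext
          intro q
          obtain ⟨v, rfl⟩ := Submodule.mkQ_surjective W q
          change W.mkQ (ρ (g * h) v) = W.mkQ (ρ g (ρ h v))
          rw [map_mul, Module.End.mul_apply] }
    have k1 := aux_D1_le_ker f1 (fun a b => aux_end_comm hW1 _ _)
    have k2 := aux_D1_le_ker f2 (fun a b => aux_end_comm hQ1 _ _)
    have e1 : ∀ g ∈ derivedSeries G 1, ∀ w ∈ W, ρ g w = w := by
      intro g hg w hw
      exact congrArg Subtype.val (DFunLike.congr_fun (k1 hg) (⟨w, hw⟩ : W))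
    have e2 : ∀ g ∈ derivedSeries G 1, ∀ v, ρ g v - v ∈ W := by
      intro g hg v
      rw [← Submodule.Quotient.eq]
      exact DFunLike.congr_fun (k2 hg) (W.mkQ v)
    have hD2 : derivedSeries G 2 = ⊥ := by
      apply aux_D3_of_D2 1
      intro a ha b hb
      apply hinj
      ext v
      have c1 := e1 a ha _ (e2 b hb v)
      have c2 := e1 b hb _ (e2 a ha v)
      rw [map_sub, sub_eq_iff_eq_add] at c1 c2
      rw [map_mul, map_mul, Module.End.mul_apply, Module.End.mul_apply, c1, c2]
      abel
    rw [eq_bot_iff, ← hD2]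
    exact derivedSeries_antitone G (by norm_num)

theorem aux_final {F V G : Type*} [Field F] [AddCommGroup V] [Module F V] [Group G]
    [Group.IsSolvable G] (n : ℕ) (hn : n.Prime) (hV : Module.finrank F V = n)
    (ρ : G →* Module.End F V) (hinj : Function.Injective ρ)
    (hirr : ∀ W : Submodule F V, (∀ g, W.map (ρ g) ≤ W) → W = ⊥ ∨ W = ⊤) :
    derivedSeries G 6 = ⊥ := by
  have : Fact n.Prime := ⟨hn⟩
  rcases aux_main n hn hV ρ hinj hirr with h | ⟨ψ, hψ⟩
  · rw [eq_bot_iff, ← h]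
    exact derivedSeries_antitone G (by norm_num)
  · refine aux_central ψ 4 ?_ hψ
    let φ := ψ.toHomUnits
    have hs : Group.IsSolvable φ.range :=
      Group.isSolvable_of_surjective φ.rangeRestrict_surjective
    have h4 : derivedSeries φ.range 4 = ⊥ := by
      refine aux_deg2 (F := ZMod n) (V := Fin 2 → ZMod n) (by simp)
        ((Units.coeHom _).comp φ.range.subtype) ?_
      exact Units.val_injective.comp Subtype.val_injective
    intro g hg
    exact congrArg Units.val (aux_derivedSeries_ker φ 4 h4 hg)

end DerivedLengthAux

/-- For prime `n`, an irreducible solvable subgroup of `GL(n,F)` has derived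
length at most `6`. -/
theorem derived_length_le_six_of_irreducible_solvable (n : ℕ) (hn : n.Prime)
    (F : Type*) [Field F] (G : Subgroup (GL (Fin n) F))
    (hirr : IrreducibleGL F G) (hsol : IsSolvable G) :
    derivedSeries G 6 = ⊥ := by
  have hs : Group.IsSolvable G := hsol
  let ρ : G →* Module.End F (Fin n → F) :=
    ((Matrix.toLinAlgEquiv' : Matrix (Fin n) (Fin n) F ≃ₐ[F] _) : _ →* _).comp
      ((Units.coeHom _).comp G.subtype)
  refine aux_final n hn (by simp) ρ ?_ ?_
  · exact (Matrix.toLinAlgEquiv' : Matrix (Fin n) (Fin n) F ≃ₐ[F] _).injective.comp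
      (Units.val_injective.comp Subtype.val_injective)
  · intro W hW
    exact hirr W fun g hg => hW ⟨g, hg⟩
end

section
/- Let F be a field. An irreducible solvable subgroup of SL(2,F) has derived length at most 4, and an irreducible solvable subgroup of SL(3,F) has derived length at most 5. -/
open Matrix

open scoped commutatorElement

/-- Entries of an element of `SL(2, ZMod p)`. -/
def en {p : ℕ} (M : Matrix.SpecialLinearGroup (Fin 2) (ZMod p)) (i j : Fin 2) : ZMod p :=
  (M : Matrix (Fin 2) (Fin 2) (ZMod p)) i j

theorem en_mul {p : ℕ} (M N : Matrix.SpecialLinearGroup (Fin 2) (ZMod p)) (i j : Fin 2) :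
    en (M * N) i j = en M i 0 * en N 0 j + en M i 1 * en N 1 j := by
  simp [en, Matrix.mul_apply, Fin.sum_univ_two]

theorem en_inv00 {p : ℕ} (M : Matrix.SpecialLinearGroup (Fin 2) (ZMod p)) :
    en M⁻¹ 0 0 = en M 1 1 := by simp [en, Matrix.adjugate_fin_two]
theorem en_inv01 {p : ℕ} (M : Matrix.SpecialLinearGroup (Fin 2) (ZMod p)) :
    en M⁻¹ 0 1 = - en M 0 1 := by simp [en, Matrix.adjugate_fin_two]
theorem en_inv10 {p : ℕ} (M : Matrix.SpecialLinearGroup (Fin 2) (ZMod p)) :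
    en M⁻¹ 1 0 = - en M 1 0 := by simp [en, Matrix.adjugate_fin_two]
theorem en_inv11 {p : ℕ} (M : Matrix.SpecialLinearGroup (Fin 2) (ZMod p)) :
    en M⁻¹ 1 1 = en M 0 0 := by simp [en, Matrix.adjugate_fin_two]
theorem en_ext {p : ℕ} {M N : Matrix.SpecialLinearGroup (Fin 2) (ZMod p)}
    (h : ∀ i j, en M i j = en N i j) : M = N := by
  ext i j; exact h i j

theorem sl2_ext_aux {p : ℕ} (M : Matrix.SpecialLinearGroup (Fin 2) (ZMod p)) :
    en M 0 0 * en M 1 1 - en M 0 1 * en M 1 0 = 1 := by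
  unfold en
  rw [← Matrix.det_fin_two]; exact M.2

def trSub3 : Subgroup (Matrix.SpecialLinearGroup (Fin 2) (ZMod 3)) where
  carrier := {M | en M 0 0 + en M 1 1 = 0 ∨ (en M 0 1 = 0 ∧ en M 1 0 = 0)}
  one_mem' := by simp [en]
  mul_mem' := by
    intro M N hM hN
    have h1 := sl2_ext_aux M
    have h2 := sl2_ext_aux N
    change _ ∨ _ at hM
    change _ ∨ _ at hN
    change _ ∨ _
    simp only [en_mul]
    generalize en M 0 0 = a at *
    generalize en M 0 1 = b at *
    generalize en M 1 0 = c at *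
    generalize en M 1 1 = d at *
    generalize en N 0 0 = a' at *
    generalize en N 0 1 = b' at *
    generalize en N 1 0 = c' at *
    generalize en N 1 1 = d' at *
    revert a' b' c' d'
    revert a b c d
    decide +kernel
  inv_mem' := by
    intro M hM
    change _ ∨ _ at hM
    change _ ∨ _
    simpa [en_inv00, en_inv01, en_inv10, en_inv11, add_comm] using hM

theorem sl3_step1 : derivedSeries (Matrix.SpecialLinearGroup (Fin 2) (ZMod 3)) 1 ≤ trSub3 := by
  rw [derivedSeries_succ, Subgroup.commutator_le]
  intro M _ N _
  have h1 := sl2_ext_aux M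
  have h2 := sl2_ext_aux N
  change _ ∨ _
  simp only [commutatorElement_def, en_mul, en_inv00, en_inv01, en_inv10, en_inv11]
  generalize en M 0 0 = a at *
  generalize en M 0 1 = b at *
  generalize en M 1 0 = c at *
  generalize en M 1 1 = d at *
  generalize en N 0 0 = a' at *
  generalize en N 0 1 = b' at *
  generalize en N 1 0 = c' at *
  generalize en N 1 1 = d' at *
  revert a' b' c' d'
  revert a b c d
  decide +kernel

theorem sl3_step2 : derivedSeries (Matrix.SpecialLinearGroup (Fin 2) (ZMod 3)) 2 ≤
    Subgroup.center _ := by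
  rw [derivedSeries_succ, Subgroup.commutator_le]
  intro M hM N hN
  have hM := sl3_step1 hM
  have hN := sl3_step1 hN
  have h1 := sl2_ext_aux M
  have h2 := sl2_ext_aux N
  change _ ∨ _ at hM
  change _ ∨ _ at hN
  have key : en ⁅M, N⁆ 0 0 = en ⁅M, N⁆ 1 1 ∧ en ⁅M, N⁆ 0 1 = 0 ∧ en ⁅M, N⁆ 1 0 = 0 := by
    simp only [commutatorElement_def, en_mul, en_inv00, en_inv01, en_inv10, en_inv11]
    generalize en M 0 0 = a at *
    generalize en M 0 1 = b at *
    generalize en M 1 0 = c at *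
    generalize en M 1 1 = d at *
    generalize en N 0 0 = a' at *
    generalize en N 0 1 = b' at *
    generalize en N 1 0 = c' at *
    generalize en N 1 1 = d' at *
    revert a' b' c' d'
    revert a b c d
    decide +kernel
  rw [Subgroup.mem_center_iff]
  intro g
  apply en_ext
  intro i j
  simp only [en_mul]
  generalize ⁅M, N⁆ = C at key
  obtain ⟨k1, k2, k3⟩ := key
  fin_cases i <;> fin_cases j <;> simp [k1, k2, k3] <;> ring

theorem sl3_dl : derivedSeries (Matrix.SpecialLinearGroup (Fin 2) (ZMod 3)) 3 = ⊥ := by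
  rw [derivedSeries_succ, Subgroup.commutator_eq_bot_iff_le_centralizer]
  exact sl3_step2.trans (Subgroup.center_le_centralizer _)

def trSub2 : Subgroup (Matrix.SpecialLinearGroup (Fin 2) (ZMod 2)) where
  carrier := {M | en M 0 0 + en M 1 1 = 1 ∨ (en M 0 1 = 0 ∧ en M 1 0 = 0)}
  one_mem' := by simp [en]
  mul_mem' := by
    intro M N hM hN
    have h1 := sl2_ext_aux M
    have h2 := sl2_ext_aux N
    change _ ∨ _ at hM
    change _ ∨ _ at hN
    change _ ∨ _
    simp only [en_mul]
    generalize en M 0 0 = a at *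
    generalize en M 0 1 = b at *
    generalize en M 1 0 = c at *
    generalize en M 1 1 = d at *
    generalize en N 0 0 = a' at *
    generalize en N 0 1 = b' at *
    generalize en N 1 0 = c' at *
    generalize en N 1 1 = d' at *
    revert a' b' c' d'
    revert a b c d
    decide +kernel
  inv_mem' := by
    intro M hM
    change _ ∨ _ at hM
    change _ ∨ _
    simpa [en_inv00, en_inv01, en_inv10, en_inv11, add_comm] using hM

theorem sl2_step1 : derivedSeries (Matrix.SpecialLinearGroup (Fin 2) (ZMod 2)) 1 ≤ trSub2 := by
  rw [derivedSeries_succ, Subgroup.commutator_le]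
  intro M _ N _
  have h1 := sl2_ext_aux M
  have h2 := sl2_ext_aux N
  change _ ∨ _
  simp only [commutatorElement_def, en_mul, en_inv00, en_inv01, en_inv10, en_inv11]
  generalize en M 0 0 = a at *
  generalize en M 0 1 = b at *
  generalize en M 1 0 = c at *
  generalize en M 1 1 = d at *
  generalize en N 0 0 = a' at *
  generalize en N 0 1 = b' at *
  generalize en N 1 0 = c' at *
  generalize en N 1 1 = d' at *
  revert a' b' c' d'
  revert a b c d
  decide +kernel

theorem sl2_dl : derivedSeries (Matrix.SpecialLinearGroup (Fin 2) (ZMod 2)) 2 = ⊥ := by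
  rw [derivedSeries_succ, eq_bot_iff, Subgroup.commutator_le]
  intro M hM N hN
  have hM := sl2_step1 hM
  have hN := sl2_step1 hN
  have h1 := sl2_ext_aux M
  have h2 := sl2_ext_aux N
  change _ ∨ _ at hM
  change _ ∨ _ at hN
  rw [Subgroup.mem_bot, commutatorElement_eq_one_iff_mul_comm]
  have key : en (M * N) 0 0 = en (N * M) 0 0 ∧ en (M * N) 0 1 = en (N * M) 0 1 ∧
      en (M * N) 1 0 = en (N * M) 1 0 ∧ en (M * N) 1 1 = en (N * M) 1 1 := by
    simp only [en_mul]
    generalize en M 0 0 = a at *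
    generalize en M 0 1 = b at *
    generalize en M 1 0 = c at *
    generalize en M 1 1 = d at *
    generalize en N 0 0 = a' at *
    generalize en N 0 1 = b' at *
    generalize en N 1 0 = c' at *
    generalize en N 1 1 = d' at *
    revert a' b' c' d'
    revert a b c d
    decide +kernel
  apply en_ext
  intro i j
  fin_cases i <;> fin_cases j
  · exact key.1
  · exact key.2.1
  · exact key.2.2.1
  · exact key.2.2.2

theorem perm3_aux {α : Type*} [Finite α] (h : Nat.card α ≤ 3) :
    derivedSeries (Equiv.Perm α) 2 = ⊥ := by
  classical
  have := Fintype.ofFinite α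
  obtain ⟨e⟩ : Nonempty (α ↪ Fin 3) := by
    rw [Function.Embedding.nonempty_iff_card_le]
    simpa [Nat.card_eq_fintype_card] using h
  have h3 : ∀ a b c d : Equiv.Perm (Fin 3), ⁅a, b⁆ * ⁅c, d⁆ = ⁅c, d⁆ * ⁅a, b⁆ := by
    intro a b c d
    have hm : ∀ x y : Equiv.Perm (Fin 3), ⁅x, y⁆ ∈ alternatingGroup (Fin 3) := by
      intro x y
      rw [Equiv.Perm.mem_alternatingGroup, map_commutatorElement,
        commutatorElement_eq_one_iff_mul_comm, mul_comm]
    have hcard : Nat.card (alternatingGroup (Fin 3)) = 3 := by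
      have h2 := two_mul_nat_card_alternatingGroup (α := Fin 3)
      rw [Nat.card_perm, Nat.card_fin] at h2
      have : Nat.factorial 3 = 6 := rfl
      omega
    have : Fact (Nat.Prime 3) := ⟨Nat.prime_three⟩
    have hc : IsCyclic (alternatingGroup (Fin 3)) := isCyclic_of_prime_card hcard
    have hcomm := hc.isMulCommutative.is_comm.comm ⟨_, hm a b⟩ ⟨_, hm c d⟩
    exact congrArg Subtype.val hcomm
  have h4 : ∀ a b c d : Equiv.Perm α, ⁅a, b⁆ * ⁅c, d⁆ = ⁅c, d⁆ * ⁅a, b⁆ := by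
    intro a b c d
    apply Equiv.Perm.viaEmbeddingHom_injective e
    simpa only [map_mul, map_commutatorElement] using h3 _ _ _ _
  rw [derivedSeries_succ, Subgroup.commutator_eq_bot_iff_le_centralizer, derivedSeries_succ,
    Subgroup.commutator_le]
  intro a _ b _
  rw [Subgroup.mem_centralizer_iff]
  intro z hz
  have : ⁅derivedSeries (Equiv.Perm α) 0, derivedSeries (Equiv.Perm α) 0⁆ ≤ Subgroup.centralizer {⁅a, b⁆} := by
    rw [Subgroup.commutator_le]
    intro c _ d _
    rw [Subgroup.mem_centralizer_singleton_iff]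
    exact h4 _ _ _ _
  exact Subgroup.mem_centralizer_singleton_iff.1 (this hz)

set_option linter.unusedSimpArgs false

section RepPart

variable {K V G : Type*} [Field K] [AddCommGroup V] [Module K V] [Group G]

theorem rep_comm_step (ρ : Representation K G V) (H : Subgroup G)
    (h : ∀ g ∈ H, ∀ k ∈ H, ρ g * ρ k = ρ k * ρ g) : ⁅H, H⁆ ≤ MonoidHom.ker ρ := by
  rw [Subgroup.commutator_le]
  intro g hg k hk
  rw [MonoidHom.mem_ker, commutatorElement_def, map_mul, map_mul, map_mul, h g hg k hk,
    mul_assoc (ρ k), ← map_mul, mul_inv_cancel, map_one, mul_one, ← map_mul, mul_inv_cancel,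
    map_one]

theorem rep_reducible (ρ : Representation K G V) (W : Submodule K V)
    (hW : ∀ g, W ≤ W.comap (ρ g)) (k : ℕ)
    (h1 : derivedSeries G k ≤ MonoidHom.ker (ρ.subrepresentation W hW))
    (h2 : derivedSeries G k ≤ MonoidHom.ker (ρ.quotient W hW)) :
    derivedSeries G (k + 1) ≤ MonoidHom.ker ρ := by
  rw [derivedSeries_succ]
  apply rep_comm_step
  have a1 : ∀ g ∈ derivedSeries G k, ∀ w ∈ W, ρ g w = w := by
    intro g hg w hw
    have := LinearMap.congr_fun (MonoidHom.mem_ker.1 (h1 hg)) ⟨w, hw⟩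
    exact congrArg Subtype.val this
  have a2 : ∀ g ∈ derivedSeries G k, ∀ v, ρ g v - v ∈ W := by
    intro g hg v
    have := LinearMap.congr_fun (MonoidHom.mem_ker.1 (h2 hg)) (Submodule.Quotient.mk v)
    exact (Submodule.Quotient.eq W).1 this
  intro g hg k hk
  ext v
  have e1 := a1 g hg _ (a2 k hk v)
  have e2 := a1 k hk _ (a2 g hg v)
  rw [map_sub] at e1 e2
  simp only [Module.End.mul_apply]
  rw [sub_eq_iff_eq_add.1 e1, sub_eq_iff_eq_add.1 e2]
  abel

theorem rep_dim_one (ρ : Representation K G V) (h : Module.finrank K V = 1) :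
    derivedSeries G 1 ≤ MonoidHom.ker ρ := by
  rw [derivedSeries_succ]
  apply rep_comm_step
  intro g _ k _
  obtain ⟨a, ha, -⟩ := LinearMap.existsUnique_eq_smul_id_of_finrank_eq_one h (ρ g)
  obtain ⟨b, hb, -⟩ := LinearMap.existsUnique_eq_smul_id_of_finrank_eq_one h (ρ k)
  rw [ha, hb]
  ext v
  simp [smul_smul, mul_comm]

/-- Centralizer of a Weyl pair is scalar. -/
theorem weyl_scalar [IsAlgClosed K] {p : ℕ} (hp : Module.finrank K V = p)
    (hp0 : 0 < p) {ω : K} (hω : IsPrimitiveRoot ω p) (X Y T : Module.End K V)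
    (hX : Function.Injective X) (hY : Function.Injective Y)
    (hXY : ∀ v, X (Y v) = ω • Y (X v)) (hTX : ∀ v, T (X v) = X (T v))
    (hTY : ∀ v, T (Y v) = Y (T v)) : ∃ c : K, T = c • 1 := by
  have : FiniteDimensional K V := FiniteDimensional.of_finrank_pos (hp ▸ hp0)
  have : Nontrivial V := Module.finrank_pos_iff.1 (hp ▸ hp0)
  obtain ⟨t, ht⟩ := Module.End.exists_eigenvalue T
  have hinv : ∀ v ∈ Module.End.eigenspace T t, X v ∈ Module.End.eigenspace T t := by
    intro v hv
    rw [Module.End.mem_eigenspace_iff] at hv ⊢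
    rw [hTX, hv, map_smul]
  have : Nontrivial (Module.End.eigenspace T t) := by
    rw [Submodule.nontrivial_iff_ne_bot]; exact ht
  obtain ⟨a, ha⟩ := Module.End.exists_eigenvalue (X.restrict hinv)
  obtain ⟨⟨v, hvt⟩, hv⟩ := ha.exists_hasEigenvector
  have hXv : X v = a • v := congrArg Subtype.val hv.apply_eq_smul
  have hv0 : v ≠ 0 := fun h => hv.2 (Subtype.ext h)
  rw [Module.End.mem_eigenspace_iff] at hvt
  have ha0 : a ≠ 0 := by
    rintro rfl
    rw [zero_smul] at hXv
    exact hv0 (hX (by rw [hXv, map_zero]))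
  have e1 : ∀ i : ℕ, X ((Y ^ i) v) = (ω ^ i * a) • (Y ^ i) v := by
    intro i
    induction i with
    | zero => simpa using hXv
    | succ i ih =>
      rw [pow_succ', Module.End.mul_apply, hXY, ih, map_smul, smul_smul]
      ring_nf
  have e2 : ∀ i : ℕ, T ((Y ^ i) v) = t • (Y ^ i) v := by
    intro i
    induction i with
    | zero => simpa using hvt
    | succ i ih =>
      rw [pow_succ', Module.End.mul_apply, hTY, ih, map_smul]
  have e3 : ∀ i : ℕ, (Y ^ i) v ≠ 0 := by
    intro i
    induction i with
    | zero => simpa using hv0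
    | succ i ih =>
      rw [pow_succ', Module.End.mul_apply]
      intro h
      exact ih (hY (by rw [h, map_zero]))
  have li : LinearIndependent K (fun i : Fin p => (Y ^ (i : ℕ)) v) := by
    apply Module.End.eigenvectors_linearIndependent' X (fun i : Fin p => ω ^ (i : ℕ) * a)
    · intro i j hij
      have := mul_right_cancel₀ ha0 hij
      exact Fin.ext (hω.pow_inj i.2 j.2 this)
    · intro i
      exact ⟨Module.End.mem_eigenspace_iff.2 (e1 i), e3 i⟩
  have : Nonempty (Fin p) := ⟨⟨0, hp0⟩⟩
  have sp := li.span_eq_top_of_card_eq_finrank (by simp [hp])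
  refine ⟨t, LinearMap.ext_on_range sp ?_⟩
  intro i
  simpa using e2 i

end RepPart

section GroupPart

variable {P : Type*} [Group P] {p : ℕ}

/-- `g` acts by conjugation on the commuting pair `x, y` through the matrix `M`. -/
def ActsBy (x y : P) (g : P) (M : Matrix.SpecialLinearGroup (Fin 2) (ZMod p)) : Prop :=
  ∃ a b c d : ℤ, (a : ZMod p) = en M 0 0 ∧ (b : ZMod p) = en M 0 1 ∧ (c : ZMod p) = en M 1 0 ∧
    (d : ZMod p) = en M 1 1 ∧ g * x * g⁻¹ = x ^ a * y ^ c ∧ g * y * g⁻¹ = x ^ b * y ^ d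

theorem zpow_congr_zmod {x : P} (hx : x ^ p = 1) {a b : ℤ} (h : (a : ZMod p) = b) :
    x ^ a = x ^ b := by
  rw [ZMod.intCast_eq_intCast_iff_dvd_sub] at h
  obtain ⟨k, hk⟩ := h
  rw [show b = a + p * k by linarith, _root_.zpow_add, _root_.zpow_mul, zpow_natCast, hx, _root_.one_zpow, mul_one]

theorem comm_zpow_mul {x y : P} (hxy : Commute x y) (a c a' c' e f : ℤ) :
    (x ^ a * y ^ c) ^ e * (x ^ a' * y ^ c') ^ f = x ^ (a * e + a' * f) * y ^ (c * e + c' * f) := by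
  have h : ∀ m n : ℤ, Commute (x ^ m) (y ^ n) := fun m n => (hxy.zpow_left m).zpow_right n
  rw [(h _ _).mul_zpow, (h _ _).mul_zpow, ← _root_.zpow_mul, ← _root_.zpow_mul, ← _root_.zpow_mul, ← _root_.zpow_mul, _root_.zpow_add,
    _root_.zpow_add, mul_assoc, mul_assoc, ← mul_assoc (y ^ (c * e)), ← (h _ _).eq, mul_assoc]

theorem conj_zpow_mul (g u v : P) (e f : ℤ) :
    g * (u ^ e * v ^ f) * g⁻¹ = (g * u * g⁻¹) ^ e * (g * v * g⁻¹) ^ f := by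
  rw [conj_zpow, conj_zpow]; group

theorem ActsBy.mul {x y : P} (hxy : Commute x y) {g h : P}
    {M N : Matrix.SpecialLinearGroup (Fin 2) (ZMod p)} (hg : ActsBy x y g M)
    (hh : ActsBy x y h N) : ActsBy x y (g * h) (M * N) := by
  obtain ⟨a, b, c, d, ha, hb, hc, hd, e1, e2⟩ := hg
  obtain ⟨a', b', c', d', ha', hb', hc', hd', e1', e2'⟩ := hh
  refine ⟨a * a' + b * c', a * b' + b * d', c * a' + d * c', c * b' + d * d', ?_, ?_, ?_, ?_, ?_, ?_⟩
  · simp [en_mul, ha, hb, hc, hd, ha', hb', hc', hd']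
  · simp [en_mul, ha, hb, hc, hd, ha', hb', hc', hd']
  · simp [en_mul, ha, hb, hc, hd, ha', hb', hc', hd']
  · simp [en_mul, ha, hb, hc, hd, ha', hb', hc', hd']
  · rw [← comm_zpow_mul hxy, ← e1, ← e2, ← conj_zpow_mul, ← e1']; group
  · rw [← comm_zpow_mul hxy, ← e1, ← e2, ← conj_zpow_mul, ← e2']; group

theorem ActsBy.inv {x y : P} (hxy : Commute x y) (hx : x ^ p = 1) (hy : y ^ p = 1) {g : P}
    {M : Matrix.SpecialLinearGroup (Fin 2) (ZMod p)} (hg : ActsBy x y g M) :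
    ActsBy x y g⁻¹ M⁻¹ := by
  obtain ⟨a, b, c, d, ha, hb, hc, hd, e1, e2⟩ := hg
  have hdet : ((a * d - b * c : ℤ) : ZMod p) = (1 : ℤ) := by
    push_cast
    rw [ha, hb, hc, hd]
    exact sl2_ext_aux M
  refine ⟨d, -b, -c, a, ?_, ?_, ?_, ?_, ?_, ?_⟩
  · simp [en_inv00, hd]
  · simp [en_inv01, hb]
  · simp [en_inv10, hc]
  · simp [en_inv11, ha]
  · have : g * (x ^ d * y ^ (-c)) * g⁻¹ = x := by
      rw [conj_zpow_mul, e1, e2, comm_zpow_mul hxy,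
        show a * d + b * -c = a * d - b * c by ring, show c * d + d * -c = 0 by ring,
        zpow_congr_zmod hx hdet]
      simp
    have h2 := congrArg (fun z => g⁻¹ * z * g⁻¹⁻¹) this
    refine h2.symm.trans ?_
    group
  · have : g * (x ^ (-b) * y ^ a) * g⁻¹ = y := by
      rw [conj_zpow_mul, e1, e2, comm_zpow_mul hxy,
        show c * -b + d * a = a * d - b * c by ring, show a * -b + b * a = 0 by ring,
        zpow_congr_zmod hy hdet]
      simp
    have h2 := congrArg (fun z => g⁻¹ * z * g⁻¹⁻¹) this
    refine h2.symm.trans ?_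
    group

theorem actsBy_series {x y : P} (hxy : Commute x y) (hx : x ^ p = 1) (hy : y ^ p = 1)
    (hall : ∀ g, ∃ M : Matrix.SpecialLinearGroup (Fin 2) (ZMod p), ActsBy x y g M) (k : ℕ) :
    ∀ g ∈ derivedSeries P k,
      ∃ M ∈ derivedSeries (Matrix.SpecialLinearGroup (Fin 2) (ZMod p)) k, ActsBy x y g M := by
  induction k with
  | zero =>
    intro g _
    obtain ⟨M, hM⟩ := hall g
    exact ⟨M, by simp, hM⟩
  | succ k ih =>
    let H : Subgroup P :=
      { carrier := {g | ∃ M ∈ derivedSeries (Matrix.SpecialLinearGroup (Fin 2) (ZMod p)) (k + 1),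
          ActsBy x y g M}
        one_mem' := ⟨1, one_mem _, 1, 0, 0, 1, by simp [en], by simp [en], by simp [en],
          by simp [en], by simp, by simp⟩
        mul_mem' := by
          rintro g h ⟨M, hM, hgM⟩ ⟨N, hN, hhN⟩
          exact ⟨M * N, mul_mem hM hN, hgM.mul hxy hhN⟩
        inv_mem' := by
          rintro g ⟨M, hM, hgM⟩
          exact ⟨M⁻¹, inv_mem hM, hgM.inv hxy hx hy⟩ }
    suffices derivedSeries P (k + 1) ≤ H from fun g hg => this hg
    rw [derivedSeries_succ, Subgroup.commutator_le]
    intro g hg h hh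
    obtain ⟨M, hM, hgM⟩ := ih g hg
    obtain ⟨N, hN, hhN⟩ := ih h hh
    refine ⟨⁅M, N⁆, ?_, ?_⟩
    · rw [derivedSeries_succ]; exact Subgroup.commutator_mem_commutator hM hN
    · exact ((hgM.mul hxy hhN).mul hxy (hgM.inv hxy hx hy)).mul hxy (hhN.inv hxy hx hy)

theorem actsBy_final {x y : P} (hxy : Commute x y) (hx : x ^ p = 1) (hy : y ^ p = 1)
    (hall : ∀ g, ∃ M : Matrix.SpecialLinearGroup (Fin 2) (ZMod p), ActsBy x y g M) (k : ℕ)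
    (hk : derivedSeries (Matrix.SpecialLinearGroup (Fin 2) (ZMod p)) k = ⊥) :
    ∀ g ∈ derivedSeries P k, Commute g x ∧ Commute g y := by
  intro g hg
  obtain ⟨M, hM, a, b, c, d, ha, hb, hc, hd, e1, e2⟩ := actsBy_series hxy hx hy hall k g hg
  rw [hk, Subgroup.mem_bot] at hM
  subst hM
  have ha : (a : ZMod p) = (1 : ℤ) := by simp [ha, en]
  have hb : (b : ZMod p) = (0 : ℤ) := by simp [hb, en]
  have hc : (c : ZMod p) = (0 : ℤ) := by simp [hc, en]
  have hd : (d : ZMod p) = (1 : ℤ) := by simp [hd, en]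
  rw [zpow_congr_zmod hx ha, zpow_congr_zmod hy hc, zpow_one, zpow_zero, mul_one,
    mul_inv_eq_iff_eq_mul] at e1
  rw [zpow_congr_zmod hx hb, zpow_congr_zmod hy hd, zpow_one, zpow_zero, one_mul,
    mul_inv_eq_iff_eq_mul] at e2
  exact ⟨e1, e2⟩

end GroupPart

section Heis

variable {K V G : Type*} [Field K] [AddCommGroup V] [Module K V] [Group G]

/-- `u` and `v` commute up to the scalar `ω ^ i`. -/
def Com (ρ : Representation K G V) (ω : K) (u v : G) (i : ℤ) : Prop :=
  ρ u * ρ v = ω ^ i • (ρ v * ρ u)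

theorem rep_mul_inv (ρ : Representation K G V) (u : G) : ρ u * ρ u⁻¹ = 1 := by
  rw [← map_mul, mul_inv_cancel, map_one]

theorem rep_inv_mul (ρ : Representation K G V) (u : G) : ρ u⁻¹ * ρ u = 1 := by
  rw [← map_mul, inv_mul_cancel, map_one]

variable {ρ : Representation K G V} {ω : K}

theorem Com.mul_left (hω : ω ≠ 0) {u u' v : G} {i i' : ℤ} (h : Com ρ ω u v i)
    (h' : Com ρ ω u' v i') : Com ρ ω (u * u') v (i + i') := by
  unfold Com at *
  rw [map_mul, mul_assoc, h', mul_smul_comm, ← mul_assoc, h, smul_mul_assoc, smul_smul, mul_assoc,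
    mul_comm (ω ^ i'), zpow_add₀ hω]

theorem Com.symm (hω : ω ≠ 0) {u v : G} {i : ℤ} (h : Com ρ ω u v i) : Com ρ ω v u (-i) := by
  unfold Com at *
  rw [h, smul_smul, ← zpow_add₀ hω, neg_add_cancel, zpow_zero, one_smul]

theorem Com.inv_left (hω : ω ≠ 0) {u v : G} {i : ℤ} (h : Com ρ ω u v i) :
    Com ρ ω u⁻¹ v (-i) := by
  have h' := h.symm hω
  unfold Com at *
  calc ρ u⁻¹ * ρ v = ρ u⁻¹ * (ρ v * ρ u) * ρ u⁻¹ := by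
        rw [mul_assoc, mul_assoc, rep_mul_inv, mul_one]
    _ = _ := by
        rw [h', mul_smul_comm, smul_mul_assoc, ← mul_assoc, rep_inv_mul, one_mul]

theorem Com.one_left (v : G) : Com ρ ω 1 v 0 := by
  simp [Com]

theorem Com.self (v : G) : Com ρ ω v v 0 := by
  simp [Com]

theorem Com.zpow_left (hω : ω ≠ 0) {u v : G} {i : ℤ} (h : Com ρ ω u v i) (n : ℤ) :
    Com ρ ω (u ^ n) v (n * i) := by
  induction n using Int.induction_on with
  | zero => simpa using Com.one_left v
  | succ n ih =>
    have := ih.mul_left hω h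
    rwa [← _root_.zpow_add_one, ← add_one_mul] at this
  | pred n ih =>
    have := ih.mul_left hω (h.inv_left hω)
    rwa [← _root_.zpow_sub_one, ← sub_eq_add_neg, ← sub_one_mul] at this

theorem Com.scalar_left {s : G} (hs : ∃ c : K, ρ s = c • 1) (v : G) : Com ρ ω s v 0 := by
  obtain ⟨c, hc⟩ := hs
  simp [Com, hc]

theorem Com.conj {u v : G} {i : ℤ} (h : Com ρ ω u v i) (g : G) :
    Com ρ ω (g * u * g⁻¹) (g * v * g⁻¹) i := by
  unfold Com at *
  have : ∀ a b : G, ρ (g * a * g⁻¹) * ρ (g * b * g⁻¹) = ρ g * (ρ a * ρ b) * ρ g⁻¹ := by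
    intro a b
    simp only [← map_mul]
    congr 1
    group
  rw [this, this, h, mul_smul_comm, smul_mul_assoc]

theorem Com.unique [Nontrivial V] {p : ℕ} (hω : IsPrimitiveRoot ω p) (hp : 0 < p) {u v : G}
    {i j : ℤ} (h : Com ρ ω u v i) (h' : Com ρ ω u v j) : (i : ZMod p) = j := by
  have hω0 : ω ≠ 0 := hω.ne_zero hp.ne'
  unfold Com at *
  rw [h] at h'
  have h1 : (ω ^ i) • (1 : Module.End K V) = ω ^ j • 1 := by
    have := congrArg (fun z => z * (ρ u⁻¹ * ρ v⁻¹)) h'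
    simp only [smul_mul_assoc] at this
    have e : ρ v * ρ u * (ρ u⁻¹ * ρ v⁻¹) = 1 := by
      simp only [← map_mul]
      rw [show v * u * (u⁻¹ * v⁻¹) = 1 by group, map_one]
    rwa [e] at this
  obtain ⟨v, hv⟩ := exists_ne (0 : V)
  have h2 := LinearMap.congr_fun h1 v
  simp only [LinearMap.smul_apply, Module.End.one_apply] at h2
  have h3 : ω ^ i = ω ^ j := smul_left_injective K hv h2
  have h4 : ω ^ (j - i) = 1 := by
    rw [zpow_sub₀ hω0, h3, div_self (zpow_ne_zero _ hω0)]
  rw [ZMod.intCast_eq_intCast_iff_dvd_sub]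
  exact (hω.zpow_eq_one_iff_dvd _).1 h4

theorem rep_det_ne (ρ : Representation K G V) (u : G) : LinearMap.det (ρ u) ≠ 0 := by
  intro h
  have := congrArg LinearMap.det (rep_mul_inv ρ u)
  rw [map_mul, h, zero_mul, map_one] at this
  exact zero_ne_one this

theorem rep_comm_scalar (ρ : Representation K G V) {p : ℕ} (hdim : Module.finrank K V = p)
    (u v : G) {μ : K} (h : ρ ⁅u, v⁆ = μ • 1) :
    μ ^ p = 1 ∧ ρ u * ρ v = μ • (ρ v * ρ u) := by
  constructor
  · have h1 := congrArg LinearMap.det h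
    rw [LinearMap.det_smul, hdim, map_one, mul_one] at h1
    rw [← h1, commutatorElement_def, map_mul, map_mul, map_mul, map_mul, map_mul, map_mul]
    have a1 := congrArg LinearMap.det (rep_mul_inv ρ u)
    have a2 := congrArg LinearMap.det (rep_mul_inv ρ v)
    rw [map_mul, map_one] at a1 a2
    linear_combination a1 * (LinearMap.det (ρ v) * LinearMap.det (ρ v⁻¹)) + a2
  · rw [← map_mul, show u * v = ⁅u, v⁆ * (v * u) by rw [commutatorElement_def]; group, map_mul, h,
      smul_mul_assoc, one_mul, map_mul]

/-- The normal subgroup of elements acting as scalars. -/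
def scalarSub (ρ : Representation K G V) : Subgroup G where
  carrier := {g | ∃ c : K, ρ g = c • 1}
  one_mem' := ⟨1, by simp⟩
  mul_mem' := by
    rintro g h ⟨c, hc⟩ ⟨d, hd⟩
    exact ⟨c * d, by rw [map_mul, hc, hd, smul_mul_smul_comm, one_mul]⟩
  inv_mem' := by
    rintro g ⟨c, hc⟩
    have h1 := rep_mul_inv ρ g
    rw [hc, smul_mul_assoc, one_mul] at h1
    by_cases h0 : c = 0
    · refine ⟨0, ?_⟩
      rw [h0, zero_smul] at h1
      rw [← mul_one (ρ g⁻¹), ← h1, mul_zero, zero_smul]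
    · exact ⟨c⁻¹, by rw [← h1, smul_smul, inv_mul_cancel₀ h0, one_smul]⟩

instance scalarSub_normal (ρ : Representation K G V) : (scalarSub ρ).Normal where
  conj_mem := by
    rintro n ⟨c, hc⟩ g
    exact ⟨c, by rw [map_mul, map_mul, hc, mul_smul_comm, mul_one, smul_mul_assoc, rep_mul_inv]⟩

theorem rep_inj (ρ : Representation K G V) (u : G) : Function.Injective (ρ u) := by
  intro a b h
  have := congrArg (ρ u⁻¹) h
  rw [← Module.End.mul_apply, ← Module.End.mul_apply, rep_inv_mul] at this
  exact this

theorem rep_heis [IsAlgClosed K] (ρ : Representation K G V) {p : ℕ} (hp : p.Prime)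
    (hdim : Module.finrank K V = p) (B : Subgroup G) [hB : B.Normal]
    (hA : ⁅B, B⁆ ≤ scalarSub ρ) {X Y : G} (hX : X ∈ B) (hY : Y ∈ B) (hne : ρ ⁅X, Y⁆ ≠ 1)
    (hSL : derivedSeries (Matrix.SpecialLinearGroup (Fin 2) (ZMod p)) p = ⊥) :
    derivedSeries G (p + 2) ≤ MonoidHom.ker ρ := by
  have : FiniteDimensional K V := FiniteDimensional.of_finrank_pos (hdim ▸ hp.pos)
  have : Nontrivial V := Module.finrank_pos_iff.1 (hdim ▸ hp.pos)
  obtain ⟨ω, hω⟩ := hA (Subgroup.commutator_mem_commutator hX hY)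
  obtain ⟨hωp, hXY⟩ := rep_comm_scalar ρ hdim X Y hω
  have hω1 : ω ≠ 1 := by
    rintro rfl
    rw [one_smul] at hω
    exact hne hω
  have hprim : IsPrimitiveRoot ω p := by
    have := orderOf_eq_prime_iff (p := p) (x := ω) (hp := ⟨hp⟩) |>.2 ⟨hωp, hω1⟩
    exact this ▸ IsPrimitiveRoot.orderOf ω
  have hω0 : ω ≠ 0 := hprim.ne_zero hp.ne_zero
  have cXY : Com ρ ω X Y 1 := by
    unfold Com; rw [zpow_one]; exact hXY
  have cYX : Com ρ ω Y X (-1) := cXY.symm hω0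
  -- the key fact
  have key : ∀ g : G, Com ρ ω g X 0 → Com ρ ω g Y 0 → g ∈ scalarSub ρ := by
    intro g h1 h2
    unfold Com at h1 h2
    rw [zpow_zero, one_smul] at h1 h2
    exact weyl_scalar hdim hp.pos hprim (ρ X) (ρ Y) (ρ g) (rep_inj ρ X) (rep_inj ρ Y)
      (fun v => LinearMap.congr_fun hXY v) (fun v => LinearMap.congr_fun h1 v)
      (fun v => LinearMap.congr_fun h2 v)
  have exCom : ∀ u v : G, ⁅u, v⁆ ∈ scalarSub ρ → ∃ i, Com ρ ω u v i := by
    rintro u v ⟨μ, hμ⟩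
    obtain ⟨h1, h2⟩ := rep_comm_scalar ρ hdim u v hμ
    have : NeZero p := ⟨hp.ne_zero⟩
    obtain ⟨i, -, hi⟩ := hprim.eq_pow_of_pow_eq_one h1
    refine ⟨i, ?_⟩
    unfold Com
    rw [zpow_natCast, hi]
    exact h2
  let q : G →* G ⧸ scalarSub ρ := QuotientGroup.mk' (scalarSub ρ)
  have hq : ∀ g, q g = 1 ↔ g ∈ scalarSub ρ := fun g => QuotientGroup.eq_one_iff g
  have hqc : ∀ u v, Commute (q u) (q v) ↔ ⁅u, v⁆ ∈ scalarSub ρ := by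
    intro u v
    rw [← hq, map_commutatorElement, commutatorElement_eq_one_iff_commute]
  have gen : ∀ g : G, Commute (q g) (q X) → Commute (q g) (q Y) →
      ∃ i j : ℤ, q g = q X ^ i * q Y ^ j := by
    intro g h1 h2
    obtain ⟨i, hi⟩ := exCom _ _ ((hqc _ _).1 h1)
    obtain ⟨j, hj⟩ := exCom _ _ ((hqc _ _).1 h2)
    have m : g * Y ^ i * X ^ (-j) ∈ scalarSub ρ := by
      apply key
      · have := (hi.mul_left hω0 (cYX.zpow_left hω0 i)).mul_left hω0
          ((Com.self X).zpow_left hω0 (-j))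
        rwa [show i + i * -1 + -j * 0 = 0 by ring] at this
      · have := (hj.mul_left hω0 ((Com.self Y).zpow_left hω0 i)).mul_left hω0
          (cXY.zpow_left hω0 (-j))
        rwa [show j + i * 0 + -j * 1 = 0 by ring] at this
    rw [← hq, map_mul, map_mul, map_zpow, map_zpow] at m
    refine ⟨j, -i, ?_⟩
    rw [_root_.zpow_neg, mul_eq_one_iff_eq_inv, inv_inv] at m
    rw [_root_.zpow_neg, ← m]
    group
  have hxy : Commute (q X) (q Y) := (hqc _ _).2 (hA (Subgroup.commutator_mem_commutator hX hY))
  have modp : ∀ u v, Com ρ ω u v p → Com ρ ω u v 0 := by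
    intro u v h
    unfold Com at *
    rwa [zpow_natCast, hωp, ← zpow_zero ω] at h
  have modp' : ∀ u v, Com ρ ω u v (-p) → Com ρ ω u v 0 := by
    intro u v h
    unfold Com at *
    rwa [_root_.zpow_neg, zpow_natCast, hωp, inv_one, ← zpow_zero ω] at h
  have hx : (q X) ^ p = 1 := by
    rw [← map_pow, hq]
    apply key
    · have := (Com.self (ρ := ρ) (ω := ω) X).zpow_left hω0 p
      rwa [zpow_natCast, mul_zero] at this
    · have := cXY.zpow_left hω0 p
      rw [zpow_natCast, mul_one] at this
      exact modp _ _ this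
  have hy : (q Y) ^ p = 1 := by
    rw [← map_pow, hq]
    apply key
    · have := cYX.zpow_left hω0 p
      rw [zpow_natCast, mul_neg_one] at this
      exact modp' _ _ this
    · have := (Com.self (ρ := ρ) (ω := ω) Y).zpow_left hω0 p
      rwa [zpow_natCast, mul_zero] at this
  have hall : ∀ g : G ⧸ scalarSub ρ, ∃ M : Matrix.SpecialLinearGroup (Fin 2) (ZMod p),
      ActsBy (q X) (q Y) g M := by
    intro g'
    obtain ⟨g, rfl⟩ := QuotientGroup.mk'_surjective (scalarSub ρ) g'
    have cB : ∀ u ∈ B, ∀ v ∈ B, Commute (q u) (q v) := fun u hu v hv =>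
      (hqc _ _).2 (hA (Subgroup.commutator_mem_commutator hu hv))
    have gX := hB.conj_mem X hX g
    have gY := hB.conj_mem Y hY g
    obtain ⟨a, c, h1⟩ := gen _ (cB _ gX _ hX) (cB _ gX _ hY)
    obtain ⟨b, d, h2⟩ := gen _ (cB _ gY _ hX) (cB _ gY _ hY)
    have lift : ∀ (u : G) (i j : ℤ), q u = q X ^ i * q Y ^ j →
        ∃ s ∈ scalarSub ρ, u = s * (X ^ i * Y ^ j) := by
      intro u i j h
      refine ⟨u * (X ^ i * Y ^ j)⁻¹, ?_, by group⟩
      rw [← hq, map_mul, map_inv, h, map_mul, map_zpow, map_zpow, mul_inv_cancel]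
    obtain ⟨s, hs, h1'⟩ := lift _ _ _ h1
    obtain ⟨t, ht, h2'⟩ := lift _ _ _ h2
    have c1 : Com ρ ω (g * X * g⁻¹) (g * Y * g⁻¹) 1 := cXY.conj g
    have cX : Com ρ ω (g * Y * g⁻¹) X (-d) := by
      rw [h2']
      have := (Com.scalar_left ht X).mul_left hω0 (((Com.self X).zpow_left hω0 b).mul_left hω0
        (cYX.zpow_left hω0 d))
      rwa [show 0 + (b * 0 + d * -1) = -d by ring] at this
    have cY : Com ρ ω (g * Y * g⁻¹) Y b := by
      rw [h2']
      have := (Com.scalar_left ht Y).mul_left hω0 ((cXY.zpow_left hω0 b).mul_left hω0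
        ((Com.self Y).zpow_left hω0 d))
      rwa [show 0 + (b * 1 + d * 0) = b by ring] at this
    have c2 : Com ρ ω (g * X * g⁻¹) (g * Y * g⁻¹) (a * d - b * c) := by
      rw [h1']
      have := (Com.scalar_left hs (g * Y * g⁻¹)).mul_left hω0
        (((cX.symm hω0).zpow_left hω0 a).mul_left hω0 ((cY.symm hω0).zpow_left hω0 c))
      rwa [show 0 + (a * - -d + c * -b) = a * d - b * c by ring] at this
    have hdet := c2.unique hprim hp.pos c1
    refine ⟨⟨!![(a : ZMod p), b; c, d], ?_⟩, a, b, c, d, rfl, rfl, rfl, rfl, ?_, ?_⟩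
    · rw [Matrix.det_fin_two_of]
      push_cast at hdet
      exact hdet
    · rw [← h1, map_mul, map_mul, map_inv]
    · rw [← h2, map_mul, map_mul, map_inv]
  have fin1 := actsBy_final hxy hx hy hall p hSL
  have s1 : ∀ g ∈ derivedSeries G p, ∃ i j : ℤ, q g = q X ^ i * q Y ^ j := by
    intro g hg
    have := fin1 (q g) (map_derivedSeries_le_derivedSeries q p (Subgroup.mem_map_of_mem q hg))
    exact gen g this.1 this.2
  have s2 : derivedSeries G (p + 1) ≤ scalarSub ρ := by
    rw [derivedSeries_succ, Subgroup.commutator_le]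
    intro g hg h hh
    obtain ⟨i, j, h1⟩ := s1 g hg
    obtain ⟨i', j', h2⟩ := s1 h hh
    rw [← hqc, h1, h2]
    have cc : ∀ m n : ℤ, Commute (q X ^ m) (q Y ^ n) :=
      fun m n => (hxy.zpow_left m).zpow_right n
    exact Commute.mul_left (Commute.mul_right (Commute.zpow_zpow_self _ _ _) (cc _ _))
      (Commute.mul_right (cc _ _).symm (Commute.zpow_zpow_self _ _ _))
  rw [derivedSeries_succ]
  apply rep_comm_step
  intro g hg h _
  obtain ⟨c, hc⟩ := s2 hg
  rw [hc, smul_mul_assoc, mul_smul_comm, one_mul, mul_one]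

end Heis

section Monomial

variable {K V G : Type*} [Field K] [AddCommGroup V] [Module K V] [Group G]

/-- Weight spaces of a subgroup. -/
def wt (ρ : Representation K G V) (A : Subgroup G) (χ : A → K) : Submodule K V :=
  ⨅ a : A, Module.End.eigenspace (ρ a) (χ a)

theorem mem_wt {ρ : Representation K G V} {A : Subgroup G} {χ : A → K} {v : V} :
    v ∈ wt ρ A χ ↔ ∀ a : A, ρ a v = χ a • v := by
  simp [wt, Module.End.mem_eigenspace_iff]

/-- The conjugation action on weights. -/
@[reducible] def wtAction (K : Type*) (A : Subgroup G) [A.Normal] : MulAction G (A → K) where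
  smul g χ := fun a => χ (MulAut.conjNormal g⁻¹ a)
  one_smul χ := by
    funext a
    change χ (MulAut.conjNormal (1 : G)⁻¹ a) = χ a
    simp
  mul_smul g h χ := by
    funext a
    change χ (MulAut.conjNormal (g * h)⁻¹ a) =
      χ (MulAut.conjNormal h⁻¹ (MulAut.conjNormal g⁻¹ a))
    rw [_root_.mul_inv_rev, map_mul, MulAut.mul_apply]

theorem wt_map_le (ρ : Representation K G V) (A : Subgroup G) [A.Normal] (g : G) (χ : A → K) :
    (wt ρ A χ).map (ρ g) ≤ wt ρ A (fun a => χ (MulAut.conjNormal g⁻¹ a)) := by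
  rintro _ ⟨v, hv, rfl⟩
  rw [mem_wt]
  intro a
  have h1 := mem_wt.1 hv (MulAut.conjNormal g⁻¹ a)
  rw [MulAut.conjNormal_apply, inv_inv, map_mul, map_mul] at h1
  have h2 := congrArg (ρ g) h1
  rw [← Module.End.mul_apply, ← mul_assoc, ← mul_assoc, rep_mul_inv, one_mul, map_smul] at h2
  exact h2

theorem wt_indep (ρ : Representation K G V) (A : Subgroup G)
    (hA : ∀ a ∈ A, ∀ b ∈ A, ρ a * ρ b = ρ b * ρ a) : iSupIndep (wt ρ A) := by
  have := Module.End.independent_iInf_maxGenEigenspace_of_forall_mapsTo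
    (fun a : A => ρ a) (fun i j φ =>
      Module.End.mapsTo_maxGenEigenspace_of_comm (hA j j.2 i i.2) φ)
  refine this.mono fun χ => iInf_mono fun a => ?_
  exact (Module.End.genEigenspace (ρ a) (χ a)).mono le_top

theorem exists_wt [IsAlgClosed K] [FiniteDimensional K V] [Nontrivial V]
    (ρ : Representation K G V) (A : Subgroup G)
    (hA : ∀ a ∈ A, ∀ b ∈ A, ρ a * ρ b = ρ b * ρ a) : ∃ χ, wt ρ A χ ≠ ⊥ := by
  classical
  let S : Set (Submodule K V) := {U | U ≠ ⊥ ∧ ∀ a ∈ A, ∀ u ∈ U, ρ a u ∈ U}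
  have hS : S.Nonempty := ⟨⊤, top_ne_bot, fun _ _ _ _ => trivial⟩
  obtain ⟨U, ⟨hU, hUA⟩, hmin⟩ := WellFounded.has_min
    (wellFounded_lt (α := Submodule K V)) S hS
  have : Nontrivial U := (Submodule.nontrivial_iff_ne_bot).2 hU
  have key : ∀ a : A, ∃ c : K, ∀ u ∈ U, ρ a u = c • u := by
    intro a
    obtain ⟨c, hc⟩ := Module.End.exists_eigenvalue ((ρ a).restrict (hUA a a.2))
    obtain ⟨⟨v, hvU⟩, hv⟩ := hc.exists_hasEigenvector
    have hv1 : ρ a v = c • v := congrArg Subtype.val hv.apply_eq_smul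
    have hv0 : v ≠ 0 := fun h => hv.2 (Subtype.ext h)
    have hle : U ≤ Module.End.eigenspace (ρ a) c := by
      by_contra hcon
      apply hmin (U ⊓ Module.End.eigenspace (ρ a) c)
      · constructor
        · rw [Submodule.ne_bot_iff]
          exact ⟨v, ⟨hvU, Module.End.mem_eigenspace_iff.2 hv1⟩, hv0⟩
        · rintro b hb u ⟨hu1, hu2⟩
          refine ⟨hUA b hb u hu1, ?_⟩
          have hu2 : ρ a u = c • u := Module.End.mem_eigenspace_iff.1 hu2
          apply Module.End.mem_eigenspace_iff.2
          rw [← Module.End.mul_apply, hA a a.2 b hb, Module.End.mul_apply, hu2, map_smul]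
      · exact lt_of_le_of_ne inf_le_left fun h => hcon (inf_eq_left.1 h)
    exact ⟨c, fun u hu => Module.End.mem_eigenspace_iff.1 (hle hu)⟩
  choose χ hχ using key
  refine ⟨χ, fun h => hU ?_⟩
  rw [eq_bot_iff, ← h]
  intro u hu
  exact mem_wt.2 fun a => hχ a u hu

theorem rep_monomial [IsAlgClosed K] [FiniteDimensional K V] [Nontrivial V]
    (ρ : Representation K G V) (hdim : Module.finrank K V ≤ 3)
    (hirr : ∀ W : Submodule K V, (∀ g, W ≤ W.comap (ρ g)) → W = ⊥ ∨ W = ⊤)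
    (A : Subgroup G) [A.Normal] (hA : ∀ a ∈ A, ∀ b ∈ A, ρ a * ρ b = ρ b * ρ a)
    (hns : ¬ A ≤ scalarSub ρ) : derivedSeries G 3 ≤ MonoidHom.ker ρ := by
  classical
  let _ := wtAction K A
  have hmap : ∀ (g : G) (χ : A → K), (wt ρ A χ).map (ρ g) ≤ wt ρ A (g • χ) :=
    fun g χ => wt_map_le ρ A g χ
  have hind := wt_indep ρ A hA
  -- a weight orbit spans
  have hspan : ∀ χ, wt ρ A χ ≠ ⊥ → ⨆ ψ : MulAction.orbit G χ, wt ρ A ψ = ⊤ := by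
    intro χ hχ
    refine (hirr _ ?_).resolve_left ?_
    · intro g
      rw [← Submodule.map_le_iff_le_comap, Submodule.map_iSup]
      refine iSup_le fun ψ => (hmap g ψ).trans ?_
      exact le_iSup (fun ψ : MulAction.orbit G χ => wt ρ A ψ) (g • ψ)
    · intro h
      apply hχ
      rw [eq_bot_iff, ← h]
      exact le_iSup (fun ψ : MulAction.orbit G χ => wt ρ A ψ) ⟨χ, MulAction.mem_orbit_self χ⟩
  have hproper : ∀ χ, wt ρ A χ ≠ ⊤ := by
    intro χ h
    apply hns
    intro a ha
    refine ⟨χ ⟨a, ha⟩, ?_⟩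
    ext v
    have : v ∈ wt ρ A χ := h ▸ Submodule.mem_top
    simpa using mem_wt.1 this ⟨a, ha⟩
  have hone : ∃ χ, Module.finrank K (wt ρ A χ) = 1 := by
    obtain ⟨χ, hχ⟩ := exists_wt ρ A hA
    have hpos : ∀ χ, wt ρ A χ ≠ ⊥ → 0 < Module.finrank K (wt ρ A χ) := by
      intro χ h
      have := (Submodule.nontrivial_iff_ne_bot).2 h
      exact Module.finrank_pos
    by_cases h1 : Module.finrank K (wt ρ A χ) = 1
    · exact ⟨χ, h1⟩
    obtain ⟨ψ, hψ, hne⟩ : ∃ ψ, wt ρ A ψ ≠ ⊥ ∧ ψ ≠ χ := by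
      by_contra hcon
      push Not at hcon
      apply hproper χ
      rw [eq_top_iff, ← hspan χ hχ]
      refine iSup_le fun ψ => ?_
      by_cases hb : wt ρ A ψ = ⊥
      · rw [hb]; exact bot_le
      · rw [hcon _ hb]
    have hdis : Disjoint (wt ρ A ψ) (wt ρ A χ) := hind.pairwiseDisjoint hne
    have := Submodule.finrank_add_finrank_le_of_disjoint hdis
    have := hpos χ hχ
    have := hpos ψ hψ
    exact ⟨ψ, by omega⟩
  obtain ⟨χ, hχ⟩ := hone
  have hχb : wt ρ A χ ≠ ⊥ := by
    intro h
    rw [h] at hχ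
    simp at hχ
  have horb : ∀ ψ : MulAction.orbit G χ, Module.finrank K (wt ρ A ψ) ≤ 1 ∧ wt ρ A ψ ≠ ⊥ := by
    rintro ⟨_, g, rfl⟩
    have h1 : (wt ρ A (g • χ)).map (ρ g⁻¹) ≤ wt ρ A χ := by
      simpa using hmap g⁻¹ (g • χ)
    constructor
    · have h2 : wt ρ A (g • χ) ≤ (wt ρ A χ).map (ρ g) := by
        intro v hv
        refine ⟨ρ g⁻¹ v, h1 ⟨v, hv, rfl⟩, ?_⟩
        rw [← Module.End.mul_apply, rep_mul_inv, Module.End.one_apply]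
      rw [← hχ]
      exact (Submodule.finrank_mono h2).trans (Submodule.finrank_map_le _ _)
    · intro h
      have h2 := hmap g χ
      simp only at h
      rw [h, le_bot_iff] at h2
      apply hχb
      rw [eq_bot_iff]
      intro v hv
      have : ρ g v ∈ (wt ρ A χ).map (ρ g) := ⟨v, hv, rfl⟩
      rw [h2, Submodule.mem_bot] at this
      exact (Submodule.mem_bot K).2 (rep_inj ρ g (by rw [this, map_zero]))
  have hind' : iSupIndep (fun ψ : MulAction.orbit G χ => wt ρ A ψ) :=
    hind.comp Subtype.val_injective
  let e : {ψ : MulAction.orbit G χ // wt ρ A ψ ≠ ⊥} ≃ MulAction.orbit G χ :=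
    Equiv.subtypeUnivEquiv fun ψ => (horb ψ).2
  let _ : Fintype {ψ : MulAction.orbit G χ // wt ρ A ψ ≠ ⊥} :=
    hind'.fintypeNeBotOfFiniteDimensional
  have hcard := hind'.subtype_ne_bot_le_finrank
  have hfin : Finite (MulAction.orbit G χ) := Finite.of_equiv _ e
  have hcard3 : Nat.card (MulAction.orbit G χ) ≤ 3 := by
    rw [← Nat.card_congr e, Nat.card_eq_fintype_card]
    exact hcard.trans hdim
  have hfix : ∀ g ∈ derivedSeries G 2, ∀ ψ : MulAction.orbit G χ, g • ψ = ψ := by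
    intro g hg ψ
    have := map_derivedSeries_le_derivedSeries (MulAction.toPermHom G (MulAction.orbit G χ)) 2
      (Subgroup.mem_map_of_mem _ hg)
    rw [perm3_aux hcard3, Subgroup.mem_bot] at this
    exact Equiv.congr_fun this ψ
  have hline : ∀ g ∈ derivedSeries G 2, ∀ ψ : MulAction.orbit G χ, ∃ c : K,
      ∀ v ∈ wt ρ A ψ, ρ g v = c • v := by
    intro g hg ψ
    have hinv : ∀ v ∈ wt ρ A ψ, ρ g v ∈ wt ρ A ψ := by
      intro v hv
      have h1 : ρ g v ∈ wt ρ A (g • (ψ : A → K)) := hmap g ψ ⟨v, hv, rfl⟩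
      have h2 : g • (ψ : A → K) = ψ := congrArg Subtype.val (hfix g hg ψ)
      rwa [h2] at h1
    obtain ⟨h1, h2⟩ := horb ψ
    have := (Submodule.nontrivial_iff_ne_bot).2 h2
    have h3 : Module.finrank K (wt ρ A ψ) = 1 := le_antisymm h1 Module.finrank_pos
    obtain ⟨c, hc, -⟩ :=
      LinearMap.existsUnique_eq_smul_id_of_finrank_eq_one h3 ((ρ g).restrict hinv)
    exact ⟨c, fun v hv => congrArg Subtype.val (LinearMap.congr_fun hc ⟨v, hv⟩)⟩
  rw [derivedSeries_succ]
  apply rep_comm_step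
  intro g hg h hh
  have hle : (⊤ : Submodule K V) ≤ LinearMap.eqLocus (ρ g * ρ h) (ρ h * ρ g) := by
    rw [← hspan χ hχb]
    refine iSup_le fun ψ v hv => ?_
    obtain ⟨c, hc⟩ := hline g hg ψ
    obtain ⟨d, hd⟩ := hline h hh ψ
    rw [LinearMap.mem_eqLocus, Module.End.mul_apply, Module.End.mul_apply, hd v hv, hc v hv,
      map_smul, map_smul, hd v hv, hc v hv, smul_smul, smul_smul, mul_comm]
  ext v
  exact hle (Submodule.mem_top (x := v))

end Monomial

section Main

variable {K V G : Type*} [Field K] [AddCommGroup V] [Module K V] [Group G]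

theorem rep_irred [IsAlgClosed K] (ρ : Representation K G V) [hsol : Group.IsSolvable G] {p : ℕ}
    (hp : p.Prime) (hp3 : p ≤ 3) (hdim : Module.finrank K V = p)
    (hirr : ∀ W : Submodule K V, (∀ g, W ≤ W.comap (ρ g)) → W = ⊥ ∨ W = ⊤)
    (hSL : derivedSeries (Matrix.SpecialLinearGroup (Fin 2) (ZMod p)) p = ⊥) :
    derivedSeries G (p + 2) ≤ MonoidHom.ker ρ := by
  classical
  have : FiniteDimensional K V := FiniteDimensional.of_finrank_pos (hdim ▸ hp.pos)
  have : Nontrivial V := Module.finrank_pos_iff.1 (hdim ▸ hp.pos)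
  by_contra hcon
  have hex : ∃ n, derivedSeries G n ≤ MonoidHom.ker ρ := by
    obtain ⟨n, hn⟩ := hsol.solvable
    exact ⟨n, by rw [hn]; exact bot_le⟩
  have hd := Nat.find_spec hex
  have hmin : ∀ m, m < Nat.find hex → ¬ derivedSeries G m ≤ MonoidHom.ker ρ :=
    fun m hm => Nat.find_min hex hm
  generalize Nat.find hex = d at hd hmin
  have hdp : p + 2 < d := by
    by_contra h
    exact hcon ((derivedSeries_antitone G (not_lt.1 h)).trans hd)
  obtain ⟨e, rfl⟩ : ∃ e, d = e + 2 := ⟨d - 2, by omega⟩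
  have n1 := derivedSeries_normal G (e + 1)
  have n0 := derivedSeries_normal G e
  have hAc : ∀ a ∈ derivedSeries G (e + 1), ∀ b ∈ derivedSeries G (e + 1),
      ρ a * ρ b = ρ b * ρ a := by
    intro a ha b hb
    have h1 : ⁅a, b⁆ ∈ derivedSeries G (e + 2) := by
      rw [derivedSeries_succ]; exact Subgroup.commutator_mem_commutator ha hb
    have h2 := MonoidHom.mem_ker.1 (hd h1)
    rw [← map_mul, show a * b = ⁅a, b⁆ * (b * a) by rw [commutatorElement_def]; group, map_mul, h2,
      one_mul, map_mul]
  have hsc : derivedSeries G (e + 1) ≤ scalarSub ρ := by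
    by_contra hns
    have := rep_monomial ρ (hdim ▸ hp3) hirr _ hAc hns
    exact hcon ((derivedSeries_antitone G (by have := hp.two_le; omega)).trans this)
  have hne : ∃ X ∈ derivedSeries G e, ∃ Y ∈ derivedSeries G e, ρ ⁅X, Y⁆ ≠ 1 := by
    by_contra h
    push Not at h
    apply hmin (e + 1) (by omega)
    rw [derivedSeries_succ, Subgroup.commutator_le]
    intro X hX Y hY
    exact MonoidHom.mem_ker.2 (h X hX Y hY)
  obtain ⟨X, hX, Y, hY, hXY⟩ := hne
  rw [derivedSeries_succ] at hsc
  exact hcon (rep_heis ρ hp hdim (derivedSeries G e) hsc hX hY hXY hSL)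

theorem rep_dim_two [IsAlgClosed K] (ρ : Representation K G V) [hsol : Group.IsSolvable G]
    (hdim : Module.finrank K V = 2) : derivedSeries G 4 ≤ MonoidHom.ker ρ := by
  have : FiniteDimensional K V := FiniteDimensional.of_finrank_pos (by omega)
  by_cases hirr : ∀ W : Submodule K V, (∀ g, W ≤ W.comap (ρ g)) → W = ⊥ ∨ W = ⊤
  · exact rep_irred ρ Nat.prime_two (by norm_num) hdim hirr sl2_dl
  · push Not at hirr
    obtain ⟨W, hW, hb, ht⟩ := hirr
    have h1 := Submodule.finrank_lt ht
    have h2 : 0 < Module.finrank K W := by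
      have := (Submodule.nontrivial_iff_ne_bot).2 hb
      exact Module.finrank_pos
    have h3 := Submodule.finrank_quotient_add_finrank W
    refine (derivedSeries_antitone G (show 2 ≤ 4 by norm_num)).trans
      (rep_reducible ρ W hW 1 (rep_dim_one _ (by omega)) (rep_dim_one _ (by omega)))

theorem rep_dim_three [IsAlgClosed K] (ρ : Representation K G V) [hsol : Group.IsSolvable G]
    (hdim : Module.finrank K V = 3) : derivedSeries G 5 ≤ MonoidHom.ker ρ := by
  have : FiniteDimensional K V := FiniteDimensional.of_finrank_pos (by omega)
  by_cases hirr : ∀ W : Submodule K V, (∀ g, W ≤ W.comap (ρ g)) → W = ⊥ ∨ W = ⊤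
  · exact rep_irred ρ Nat.prime_three (by norm_num) hdim hirr sl3_dl
  · push Not at hirr
    obtain ⟨W, hW, hb, ht⟩ := hirr
    have h1 := Submodule.finrank_lt ht
    have h2 : 0 < Module.finrank K W := by
      have := (Submodule.nontrivial_iff_ne_bot).2 hb
      exact Module.finrank_pos
    have h3 := Submodule.finrank_quotient_add_finrank W
    have h14 : derivedSeries G 4 ≤ derivedSeries G 1 := derivedSeries_antitone G (by norm_num)
    rcases (show Module.finrank K W = 1 ∨ Module.finrank K W = 2 by omega) with h | h
    · exact rep_reducible ρ W hW 4 (h14.trans (rep_dim_one _ h)) (rep_dim_two _ (by omega))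
    · exact rep_reducible ρ W hW 4 (rep_dim_two _ h) (h14.trans (rep_dim_one _ (by omega)))

/-- The representation over the algebraic closure given by a subgroup of `SL(n,F)`. -/
noncomputable def natRep {n : ℕ} (F : Type*) [Field F]
    (G : Subgroup (Matrix.SpecialLinearGroup (Fin n) F)) :
    Representation (AlgebraicClosure F) G (Fin n → AlgebraicClosure F) where
  toFun g := Matrix.toLin' (((g : Matrix.SpecialLinearGroup (Fin n) F) :
    Matrix (Fin n) (Fin n) F).map (algebraMap F (AlgebraicClosure F)))
  map_one' := by simp; rfl
  map_mul' g h := by simp [Matrix.map_mul, Matrix.toLin'_mul]; rfl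

theorem natRep_ker {n : ℕ} (F : Type*) [Field F]
    (G : Subgroup (Matrix.SpecialLinearGroup (Fin n) F)) : MonoidHom.ker (natRep F G) = ⊥ := by
  rw [eq_bot_iff]
  intro g hg
  have h1 : Matrix.toLin' (((g : Matrix.SpecialLinearGroup (Fin n) F) :
    Matrix (Fin n) (Fin n) F).map (algebraMap F (AlgebraicClosure F))) = Matrix.toLin' 1 := by
    rw [Matrix.toLin'_one]; exact MonoidHom.mem_ker.1 hg
  have h2 := Matrix.toLin'.injective h1
  rw [Subgroup.mem_bot]
  apply Subtype.ext
  apply Subtype.ext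
  apply Matrix.map_injective (algebraMap F (AlgebraicClosure F)).injective
  refine h2.trans ?_
  change _ = (1 : Matrix (Fin n) (Fin n) F).map _
  simp

end Main


/-- An irreducible solvable subgroup of `SL(2,F)` has derived length at most
`4`, and an irreducible solvable subgroup of `SL(3,F)` has derived length at most `5`. -/
theorem derived_length_bounds_degree_two_three (F : Type*) [Field F] :
    (∀ G : Subgroup (SL 2 F), IrreducibleSub F G → IsSolvable G → derivedSeries G 4 = ⊥) ∧
    (∀ G : Subgroup (SL 3 F), IrreducibleSub F G → IsSolvable G → derivedSeries G 5 = ⊥) := by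
  refine ⟨fun G _ hG => ?_, fun G _ hG => ?_⟩
  · rw [eq_bot_iff, ← natRep_ker F G]
    exact rep_dim_two _ (hsol := hG) (by simp)
  · rw [eq_bot_iff, ← natRep_ker F G]
    exact rep_dim_three _ (hsol := hG) (by simp)
end

section
/- Let F be a field and let G ≤ GL(n,F) be absolutely irreducible. Then there exists an invertible matrix Φ ∈ GL(n,F) such that g Φ gᵀ = Φ for all g ∈ G (i.e., G preserves a nondegenerate bilinear form on F^n) if and only if tr(g) = tr(g⁻¹) for all g ∈ G. -/
open Matrix

/-- Skolem-Noether for full matrix algebras. -/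
theorem matrix_algEquiv_inner {F : Type*} [Field F] {n : ℕ}
    (σ : Matrix (Fin n) (Fin n) F ≃ₐ[F] Matrix (Fin n) (Fin n) F) :
    ∃ P : Matrix (Fin n) (Fin n) F, IsUnit P ∧ ∀ x, σ x * P = P * x := by
  let e : Matrix (Fin n) (Fin n) F ≃ₐ[F] Module.End F (Fin n → F) := Matrix.toLinAlgEquiv'
  obtain ⟨T, hT⟩ := AlgEquiv.eq_linearEquivConjAlgEquiv ((e.symm.trans σ).trans e)
  refine ⟨e.symm T.toLinearMap, ?_, fun x => ?_⟩
  · refine IsUnit.of_mul_eq_one (e.symm T.symm.toLinearMap) ?_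
    rw [← map_mul]
    have : (T.toLinearMap * T.symm.toLinearMap : Module.End F (Fin n → F)) = 1 := by
      refine LinearMap.ext fun v => ?_
      simp
    rw [this, map_one]
  · have h := congrArg (fun f => f (e x)) hT
    simp only [AlgEquiv.trans_apply, AlgEquiv.symm_apply_apply] at h
    apply e.injective
    rw [map_mul, map_mul, h, AlgEquiv.apply_symm_apply]
    refine LinearMap.ext fun v => ?_
    simp [LinearEquiv.conjAlgEquiv_apply]

/-- Two surjective representations with the same trace are equivalent. -/
theorem exists_intertwiner {F : Type*} [Field F] {n : ℕ} {A : Type*} [Ring A] [Algebra F A]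
    (p q : A →ₐ[F] Matrix (Fin n) (Fin n) F)
    (hp : Function.Surjective p) (hq : Function.Surjective q)
    (h : ∀ a, (p a).trace = (q a).trace) :
    ∃ P : Matrix (Fin n) (Fin n) F, IsUnit P ∧ ∀ a, q a * P = P * p a := by
  have key : ∀ (p q : A →ₐ[F] Matrix (Fin n) (Fin n) F), Function.Surjective q →
      (∀ a, (p a).trace = (q a).trace) → ∀ a, p a = 0 → q a = 0 := by
    intro p q hq h a ha
    apply Matrix.ext_iff_trace_mul_left.2
    intro x
    obtain ⟨b, rfl⟩ := hq x
    rw [← map_mul, ← h, map_mul, ha]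
    simp
  have hk : RingHom.ker p = RingHom.ker q := by
    ext a
    exact ⟨key p q hq h a, key q p hp (fun a => (h a).symm) a⟩
  let σ := ((Ideal.quotientKerAlgEquivOfSurjective hp).symm.trans
    (Ideal.quotientEquivAlgOfEq F hk)).trans (Ideal.quotientKerAlgEquivOfSurjective hq)
  have hσ : ∀ a, σ (p a) = q a := by
    intro a
    have : (Ideal.quotientKerAlgEquivOfSurjective hp).symm (p a)
        = Ideal.Quotient.mk (RingHom.ker p) a := by
      rw [AlgEquiv.symm_apply_eq]
      simp
    simp [σ, this]
  obtain ⟨P, hP, h2⟩ := matrix_algEquiv_inner σ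
  exact ⟨P, hP, fun a => by rw [← hσ, h2]⟩

/-- An absolutely irreducible `G ≤ GL(n,F)` preserves a nondegenerate bilinear
form iff `tr(g) = tr(g⁻¹)` for all `g ∈ G`. -/
theorem isometry_iff_trace_symmetric (F : Type*) [Field F] (n : ℕ)
    (G : Subgroup (GL (Fin n) F))
    (habs : Algebra.adjoin F
      ((fun g : GL (Fin n) F => (g : Matrix (Fin n) (Fin n) F)) '' (G : Set _)) = ⊤) :
    (∃ Φ : Matrix (Fin n) (Fin n) F, IsUnit Φ ∧
        ∀ g ∈ G, (g : Matrix (Fin n) (Fin n) F) * Φ * (g : Matrix (Fin n) (Fin n) F)ᵀ = Φ) ↔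
      ∀ g ∈ G, (g : Matrix (Fin n) (Fin n) F).trace
        = ((g⁻¹ : GL (Fin n) F) : Matrix (Fin n) (Fin n) F).trace := by
  constructor
  · rintro ⟨Φ, hΦ, h⟩ g hg
    obtain ⟨u, rfl⟩ := hΦ
    have h1 : ((g⁻¹ : GL (Fin n) F) : Matrix (Fin n) (Fin n) F)
        = u * (g : Matrix (Fin n) (Fin n) F)ᵀ * (u⁻¹ : GL (Fin n) F) := by
      rw [Units.eq_mul_inv_iff_mul_eq, Units.inv_mul_eq_iff_eq_mul, ← mul_assoc]
      exact (h g hg).symm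
    rw [h1, Matrix.trace_mul_comm, ← mul_assoc, Units.inv_mul, one_mul, Matrix.trace_transpose]
  · intro h
    let f : G →* Matrix (Fin n) (Fin n) F := (Units.coeHom _).comp G.subtype
    let f' : G →* Matrix (Fin n) (Fin n) F :=
      { toFun := fun g => (f g⁻¹)ᵀ
        map_one' := by simp
        map_mul' := by intro a b; simp [_root_.mul_inv_rev] }
    let p := MonoidAlgebra.lift F (Matrix (Fin n) (Fin n) F) G f
    let q := MonoidAlgebra.lift F (Matrix (Fin n) (Fin n) F) G f'
    have hpg : ∀ g, p (MonoidAlgebra.of F G g) = f g := fun g => by simp [p]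
    have hqg : ∀ g, q (MonoidAlgebra.of F G g) = (f g⁻¹)ᵀ := fun g => by simp [q, f']
    have hp : Function.Surjective p := by
      rw [← AlgHom.range_eq_top, eq_top_iff, ← habs]
      apply Algebra.adjoin_le
      rintro _ ⟨g, hg, rfl⟩
      exact ⟨MonoidAlgebra.of F G ⟨g, hg⟩, hpg _⟩
    have hq : Function.Surjective q := by
      have : ∀ x ∈ Algebra.adjoin F ((fun g : GL (Fin n) F =>
          (g : Matrix (Fin n) (Fin n) F)) '' (G : Set _)), xᵀ ∈ q.range := by
        intro x hx
        induction hx using Algebra.adjoin_induction with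
        | mem x hx =>
          obtain ⟨g, hg, rfl⟩ := hx
          refine ⟨MonoidAlgebra.of F G (⟨g, hg⟩⁻¹ : G), (hqg _).trans ?_⟩
          rw [inv_inv]
          rfl
        | algebraMap r =>
          have : (algebraMap F (Matrix (Fin n) (Fin n) F) r)ᵀ = algebraMap F _ r := by
            simp [Matrix.algebraMap_eq_diagonal]
          rw [this]
          exact q.range.algebraMap_mem r
        | add x y _ _ hx hy => rw [Matrix.transpose_add]; exact add_mem hx hy
        | mul x y _ _ hx hy => rw [Matrix.transpose_mul]; exact mul_mem hy hx
      intro x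
      have hx := this xᵀ (by rw [habs]; trivial)
      rwa [Matrix.transpose_transpose] at hx
    have ht : ∀ a, (p a).trace = (q a).trace := by
      intro a
      induction a using MonoidAlgebra.induction_on with
      | of g =>
        rw [hpg, hqg, Matrix.trace_transpose]
        exact h g g.2
      | add x y hx hy => rw [map_add, map_add, Matrix.trace_add, Matrix.trace_add, hx, hy]
      | smul r x hx => rw [map_smul, map_smul, Matrix.trace_smul, Matrix.trace_smul, hx]
    obtain ⟨P, ⟨u, rfl⟩, hP⟩ := exists_intertwiner p q hp hq ht
    refine ⟨((u⁻¹ : GL (Fin n) F) : Matrix (Fin n) (Fin n) F), Units.isUnit _, fun g hg => ?_⟩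
    have h1 := hP (MonoidAlgebra.of F G (⟨g, hg⟩⁻¹ : G))
    rw [hpg, hqg, inv_inv] at h1
    change (g : Matrix (Fin n) (Fin n) F)ᵀ * u = u * ((g⁻¹ : GL (Fin n) F)) at h1
    have h2 := (Units.eq_mul_inv_iff_mul_eq u).2 h1
    rw [h2]
    simp only [← Units.val_mul]
    congr 1
    group
end

section
/- Let n be a prime and let H ≤ SL(n,ℤ). Suppose φ_p(H) = SL(n,ℤ/pℤ) for some prime p, where p > 3 if n = 2. Then H is infinite, non-solvable, and primitive (acting on ℚ^n); moreover, if n > 2 then there is no invertible matrix Φ ∈ GL(n,ℚ) with h Φ hᵀ = Φ for all h ∈ H (H is not an isometry group). -/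
open Matrix

namespace SurjModP

open scoped commutatorElement

theorem coe_mul' {n : ℕ} {R : Type*} [CommRing R] (g h : SL n R) :
    ((g * h : SL n R) : Matrix (Fin n) (Fin n) R) =
      (g : Matrix (Fin n) (Fin n) R) * (h : Matrix (Fin n) (Fin n) R) := rfl

theorem exists_primitive {ι : Type*} [Fintype ι] (v : ι → ℚ) (hv : v ≠ 0) :
    ∃ (c : ℚ) (w u : ι → ℤ), c ≠ 0 ∧ (∀ i, c * v i = w i) ∧ ∑ i, w i * u i = 1 := by
  obtain ⟨b, hb⟩ := IsLocalization.exist_integer_multiples_of_finite (nonZeroDivisors ℤ) v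
  choose f hf using hb
  have hb0 : ((b : ℤ) : ℚ) ≠ 0 := by
    exact_mod_cast nonZeroDivisors.ne_zero b.2
  obtain ⟨i0, hi0⟩ := Function.ne_iff.mp hv
  have hf' : ∀ i, (f i : ℚ) = (b : ℤ) * v i := by
    intro i
    have := hf i
    simpa using this
  obtain ⟨g, hg, hg1⟩ := Finset.extract_gcd (s := Finset.univ) f ⟨i0, Finset.mem_univ _⟩
  obtain ⟨u, hu⟩ := Finset.gcd_eq_sum_mul Finset.univ g
  have hd : ((Finset.univ.gcd f : ℤ) : ℚ) ≠ 0 := by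
    intro h0
    have h1 : (f i0 : ℚ) = 0 := by
      rw [hg i0 (Finset.mem_univ _)]; push_cast; rw [h0]; simp
    rw [hf'] at h1
    exact (mul_ne_zero hb0 hi0) h1
  refine ⟨(b : ℤ) / (Finset.univ.gcd f : ℤ), g, u, div_ne_zero hb0 hd, ?_, by rw [← hu, hg1]⟩
  intro i
  have h1 : (f i : ℚ) = (Finset.univ.gcd f : ℤ) * g i := by
    exact_mod_cast hg i (Finset.mem_univ _)
  rw [div_mul_eq_mul_div, ← hf', h1]
  field_simp

/-- A nonzero rational matrix is proportional to an integral one nonzero mod `p`. -/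
theorem exists_int_matrix {n : ℕ} (p : ℕ) (hp : p.Prime) (A : Matrix (Fin n) (Fin n) ℚ)
    (hA : A ≠ 0) :
    ∃ (c : ℚ) (B : Matrix (Fin n) (Fin n) ℤ), c ≠ 0 ∧ c • A = B.map ((↑) : ℤ → ℚ) ∧
      B.map (Int.castRingHom (ZMod p)) ≠ 0 := by
  have hv : (fun x : Fin n × Fin n => A x.1 x.2) ≠ 0 := by
    intro h
    apply hA
    ext i j
    exact congrFun h (i, j)
  obtain ⟨c, w, u, hc, hw, hu⟩ := exists_primitive _ hv
  refine ⟨c, fun i j => w (i, j), hc, ?_, ?_⟩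
  · ext i j
    exact hw (i, j)
  · intro h
    have h1 : ∀ x, (w x : ZMod p) = 0 := fun x => congrFun (congrFun h x.1) x.2
    have h2 := congrArg (Int.cast : ℤ → ZMod p) hu
    have : Fact p.Prime := ⟨hp⟩
    simp [h1] at h2

theorem map_cast_inj {n : ℕ} {A B : Matrix (Fin n) (Fin n) ℤ}
    (h : A.map (Int.castRingHom ℚ) = B.map (Int.castRingHom ℚ)) : A = B :=
  Matrix.map_injective (f := Int.castRingHom ℚ) Int.cast_injective h

theorem matQ_eq {n : ℕ} (g : SL n ℤ) :
    matQ g = (g : Matrix (Fin n) (Fin n) ℤ).map (Int.castRingHom ℚ) := rfl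

theorem matQ_mul {n : ℕ} (g h : SL n ℤ) : matQ (g * h) = matQ g * matQ h := by
  rw [matQ_eq, coe_mul', Matrix.map_mul]; rfl

theorem matQ_one {n : ℕ} : matQ (1 : SL n ℤ) = 1 := by
  simp [matQ_eq]

theorem redMod_coe {n p : ℕ} (g : SL n ℤ) : (redMod n p g : Matrix (Fin n) (Fin n) (ZMod p)) =
    (g : Matrix (Fin n) (Fin n) ℤ).map (Int.castRingHom (ZMod p)) := rfl

/-- An invariant form over `ℚ` gives a nonzero invariant form over `ℤ/p`. -/
theorem form_mod {n p : ℕ} (hp : p.Prime) (H : Subgroup (SL n ℤ))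
    (hsurj : H.map (redMod n p) = ⊤) (A : Matrix (Fin n) (Fin n) ℚ) (hA : A ≠ 0)
    (hinv : ∀ h ∈ H, matQ h * A * (matQ h)ᵀ = A) :
    ∃ B : Matrix (Fin n) (Fin n) (ZMod p), B ≠ 0 ∧ (Aᵀ = A → Bᵀ = B) ∧
      ∀ g : SL n (ZMod p), (g : Matrix (Fin n) (Fin n) (ZMod p)) * B * (g : Matrix _ _ _)ᵀ = B := by
  obtain ⟨c, B, hc, hB, hB0⟩ := exists_int_matrix p hp A hA
  change c • A = B.map (Int.castRingHom ℚ) at hB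
  refine ⟨_, hB0, ?_, ?_⟩
  · intro hs
    have : Bᵀ = B := by
      apply map_cast_inj
      rw [Matrix.transpose_map, ← hB, Matrix.transpose_smul, hs]
    rw [← Matrix.transpose_map, this]
  · intro g
    have hg : g ∈ H.map (redMod n p) := by rw [hsurj]; trivial
    obtain ⟨h, hh, rfl⟩ := hg
    have h1 : (h : Matrix (Fin n) (Fin n) ℤ) * B * (h : Matrix (Fin n) (Fin n) ℤ)ᵀ = B := by
      apply map_cast_inj
      rw [Matrix.map_mul, Matrix.map_mul, ← hB, Matrix.transpose_map, ← matQ_eq,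
        Matrix.mul_smul, Matrix.smul_mul, hinv h hh]
    rw [redMod_coe, ← Matrix.transpose_map, ← Matrix.map_mul, ← Matrix.map_mul, h1]

theorem trace_mod {n p : ℕ} (hp : p.Prime) (H : Subgroup (SL n ℤ))
    (hsurj : H.map (redMod n p) = ⊤) (A : Matrix (Fin n) (Fin n) ℚ) (hA : A ≠ 0)
    (hinv : ∀ h ∈ H, (A * matQ h).trace = 0) :
    ∃ B : Matrix (Fin n) (Fin n) (ZMod p), B ≠ 0 ∧
      ∀ g : SL n (ZMod p), (B * (g : Matrix (Fin n) (Fin n) (ZMod p))).trace = 0 := by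
  obtain ⟨c, B, hc, hB, hB0⟩ := exists_int_matrix p hp A hA
  change c • A = B.map (Int.castRingHom ℚ) at hB
  refine ⟨_, hB0, ?_⟩
  intro g
  have hg : g ∈ H.map (redMod n p) := by rw [hsurj]; trivial
  obtain ⟨h, hh, rfl⟩ := hg
  have h1 : (B * (h : Matrix (Fin n) (Fin n) ℤ)).trace = 0 := by
    have : (Int.castRingHom ℚ) (B * (h : Matrix (Fin n) (Fin n) ℤ)).trace = 0 := by
      rw [AddMonoidHom.map_trace, Matrix.map_mul, ← hB, ← matQ_eq, Matrix.smul_mul,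
        Matrix.trace_smul, hinv h hh, smul_zero]
    simpa using this
  rw [redMod_coe, ← Matrix.map_mul, ← AddMonoidHom.map_trace, h1, map_zero]

theorem form_entries {n : ℕ} {F : Type*} [CommRing F] (B : Matrix (Fin n) (Fin n) F)
    (hB : ∀ g : SL n F, (g : Matrix (Fin n) (Fin n) F) * B * (g : Matrix _ _ _)ᵀ = B) :
    (∀ i j k, i ≠ j → i ≠ k → B j k = 0) ∧ (∀ i j, i ≠ j → B j i + B i j = 0) := by
  have key : ∀ i j, i ≠ j → (1 + single i j (1 : F)) * B * (1 + single j i (1 : F)) = B := by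
    intro i j hij
    have := hB (SpecialLinearGroup.transvection hij 1)
    rw [SpecialLinearGroup.transvection_coe] at this
    simpa using this
  have h1 : ∀ i j k, i ≠ j → i ≠ k → B j k = 0 := by
    intro i j k hij hik
    have := congrFun (congrFun (key i j hij) i) k
    simpa [mul_add, add_mul, hik, hik.symm, Matrix.mul_assoc] using this
  refine ⟨h1, fun i j hij => ?_⟩
  have := congrFun (congrFun (key i j hij) i) i
  have h2 := h1 i j j hij hij
  simpa [mul_add, add_mul, Matrix.mul_assoc, h2, add_assoc] using this

theorem no_form {n p : ℕ} (hp : p.Prime) (hn : 2 < n) (H : Subgroup (SL n ℤ))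
    (hsurj : H.map (redMod n p) = ⊤) (A : Matrix (Fin n) (Fin n) ℚ) (hA : A ≠ 0)
    (hinv : ∀ h ∈ H, matQ h * A * (matQ h)ᵀ = A) : False := by
  obtain ⟨B, hB, -, hB2⟩ := form_mod hp H hsurj A hA hinv
  obtain ⟨h1, -⟩ := form_entries B hB2
  apply hB
  ext j k
  obtain ⟨i, hi⟩ := Finset.exists_mem_notMem_of_card_lt_card
    (s := {j, k}) (t := (Finset.univ : Finset (Fin n)))
    (lt_of_le_of_lt Finset.card_le_two (by simpa using hn))
  simp at hi
  exact h1 i j k hi.1 hi.2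

theorem no_form_symm {n p : ℕ} (hp : p.Prime) (hn : 2 ≤ n) (hp2 : n = 2 → 3 < p)
    (H : Subgroup (SL n ℤ))
    (hsurj : H.map (redMod n p) = ⊤) (A : Matrix (Fin n) (Fin n) ℚ) (hA : A ≠ 0)
    (hs : Aᵀ = A) (hinv : ∀ h ∈ H, matQ h * A * (matQ h)ᵀ = A) : False := by
  rcases hn.lt_or_eq with hn | rfl
  · exact no_form hp hn H hsurj A hA hinv
  obtain ⟨B, hB, hBs, hB2⟩ := form_mod hp H hsurj A hA hinv
  have hBs := hBs hs
  obtain ⟨h1, h2⟩ := form_entries B hB2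
  have : Fact p.Prime := ⟨hp⟩
  have : Fact (2 < p) := ⟨by have := hp2 rfl; omega⟩
  have h20 : (2 : ZMod p) ≠ 0 := by
    have := ZMod.neg_one_ne_one (n := p)
    intro h
    apply this
    linear_combination -h
  apply hB
  ext j k
  by_cases hjk : j = k
  · subst hjk
    obtain ⟨i, hi⟩ := exists_ne j
    exact h1 i j j hi hi
  · have h3 := h2 j k hjk
    have h4 : B k j = B j k := congrFun (congrFun hBs j) k
    rw [h4] at h3
    have : (2 : ZMod p) * B j k = 0 := by linear_combination h3
    exact (mul_eq_zero.mp this).resolve_left h20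

theorem infinite_of {n p : ℕ} (hp : p.Prime) (hn : 2 ≤ n) (hp2 : n = 2 → 3 < p)
    (H : Subgroup (SL n ℤ)) (hsurj : H.map (redMod n p) = ⊤) : Infinite H := by
  by_contra hfin
  rw [not_infinite_iff_finite] at hfin
  have := Fintype.ofFinite H
  let A : Matrix (Fin n) (Fin n) ℚ := ∑ h : H, matQ (h : SL n ℤ) * (matQ (h : SL n ℤ))ᵀ
  refine no_form_symm hp hn hp2 H hsurj A ?_ ?_ ?_
  · intro h0
    have i0 : Fin n := ⟨0, by omega⟩
    have h1 : A i0 i0 = ∑ h : H, ∑ k, (matQ (h : SL n ℤ) i0 k) ^ 2 := by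
      simp [A, Matrix.sum_apply, Matrix.mul_apply, sq]
    rw [h0] at h1
    have h2 := (Finset.sum_eq_zero_iff_of_nonneg (fun h _ =>
      Finset.sum_nonneg (fun k _ => sq_nonneg _))).mp h1.symm 1 (Finset.mem_univ _)
    have h3 := (Finset.sum_eq_zero_iff_of_nonneg (fun k _ => sq_nonneg _)).mp h2 i0
      (Finset.mem_univ _)
    simp [matQ_one] at h3
  · simp [A, Matrix.transpose_sum, Matrix.transpose_mul]
  · intro h hh
    simp only [A, Finset.mul_sum, Finset.sum_mul]
    refine Fintype.sum_equiv (Equiv.mulLeft (⟨h, hh⟩ : H)) _ _ fun x => ?_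
    simp [matQ_mul, Matrix.mul_assoc, Matrix.transpose_mul]

theorem trace_entries {n : ℕ} {F : Type*} [CommRing F] (hn : 2 ≤ n) (B : Matrix (Fin n) (Fin n) F)
    (hB : ∀ g : SL n F, (B * (g : Matrix (Fin n) (Fin n) F)).trace = 0) : B = 0 := by
  have h0 : B.trace = 0 := by simpa using hB 1
  have h1 : ∀ i j, i ≠ j → B j i = 0 := by
    intro i j hij
    have := hB (SpecialLinearGroup.transvection hij 1)
    rw [SpecialLinearGroup.transvection_coe] at this
    simpa [mul_add, h0, Matrix.trace_mul_single] using this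
  have : Nontrivial (Fin n) := Fin.nontrivial_iff_two_le.mpr hn
  ext j i
  by_cases hij : i = j
  · subst hij
    obtain ⟨j, hj⟩ := exists_ne i
    have := hB (SpecialLinearGroup.transvection hj.symm 1 * SpecialLinearGroup.transvection hj 1)
    rw [coe_mul', SpecialLinearGroup.transvection_coe,
      SpecialLinearGroup.transvection_coe] at this
    simpa [mul_add, add_mul, h0, Matrix.trace_mul_single, h1 _ _ hj, h1 _ _ hj.symm] using this
  · exact h1 i j hij

theorem irreducible_of {n p : ℕ} (hp : p.Prime) (hn : 2 ≤ n)
    (H : Subgroup (SL n ℤ)) (hsurj : H.map (redMod n p) = ⊤) : IrreducibleQ H := by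
  intro W hW
  by_contra hcon
  push Not at hcon
  obtain ⟨hbot, htop⟩ := hcon
  obtain ⟨w, hw, hw0⟩ := Submodule.exists_mem_ne_zero_of_ne_bot hbot
  obtain ⟨f, hf0, hf⟩ := Submodule.exists_dual_map_eq_bot_of_lt_top htop.lt_top inferInstance
  have hfW : ∀ x ∈ W, f x = 0 := fun x hx => by
    have : f x ∈ W.map f := Submodule.mem_map_of_mem hx
    rw [hf] at this
    simpa using this
  let f' : Fin n → ℚ := fun i => f (Pi.single i 1)
  have hff : ∀ x, f x = f' ⬝ᵥ x := by
    intro x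
    conv_lhs => rw [← Finset.univ_sum_single x]
    rw [map_sum]
    refine Finset.sum_congr rfl fun i _ => ?_
    have : (Pi.single i (x i) : Fin n → ℚ) = x i • Pi.single i 1 := by
      simp [← Pi.single_smul]
    rw [this, map_smul, smul_eq_mul, mul_comm]
  have hA : Matrix.vecMulVec w f' ≠ 0 := by
    intro h
    obtain ⟨i, hi⟩ := Function.ne_iff.mp hw0
    apply hf0
    ext j
    have := congrFun (congrFun h i) j
    simp [Matrix.vecMulVec_apply] at this hi
    simpa [f', hi] using this
  obtain ⟨B, hB, hB2⟩ := trace_mod hp H hsurj _ hA (by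
    intro h hh
    have h1 : matQ h *ᵥ w ∈ W := hW h hh ⟨w, hw, by simp⟩
    have h2 := hfW _ h1
    rw [hff] at h2
    rw [Matrix.vecMulVec_mul, Matrix.trace_vecMulVec, dotProduct_comm, ← h2,
      Matrix.dotProduct_mulVec])
  exact hB (trace_entries hn B hB2)

theorem not_solvable_SL {n p : ℕ} (hp : p.Prime) (hn : 2 ≤ n) (hp2 : n = 2 → 3 < p) :
    ¬ Group.IsSolvable (SL n (ZMod p)) := by
  have : Fact p.Prime := ⟨hp⟩
  have : Nontrivial (Fin n) := Fin.nontrivial_iff_two_le.mpr hn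
  obtain ⟨i, j, hij⟩ := exists_pair_ne (Fin n)
  have hne : SpecialLinearGroup.transvection hij (1 : ZMod p) ≠ 1 := by
    intro h
    have := congrArg (fun g : SL n (ZMod p) => (g : Matrix (Fin n) (Fin n) (ZMod p)) i j) h
    simp [SpecialLinearGroup.transvection_coe, hij] at this
  rcases hn.lt_or_eq with hn | rfl
  · refine not_isSolvable_of_mem_derivedSeries hne ?_
    intro k
    have : ∀ (i j : Fin n) (hij : i ≠ j) (a : ZMod p),
        SpecialLinearGroup.transvection hij a ∈ derivedSeries (SL n (ZMod p)) k := by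
      induction k with
      | zero => intros; simp
      | succ k ih =>
        intro i j hij a
        obtain ⟨l, hl⟩ := Finset.exists_mem_notMem_of_card_lt_card
          (s := {i, j}) (t := (Finset.univ : Finset (Fin n)))
          (lt_of_le_of_lt Finset.card_le_two (by simpa using hn))
        simp at hl
        obtain ⟨hli, hlj⟩ := hl
        have e : SpecialLinearGroup.transvection hij a =
          ⁅SpecialLinearGroup.transvection (Ne.symm hli) a,
            SpecialLinearGroup.transvection hlj (1 : ZMod p)⁆ := by
          rw [commutatorElement_def, eq_mul_inv_iff_mul_eq, eq_mul_inv_iff_mul_eq]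
          apply Subtype.ext
          simp only [coe_mul', SpecialLinearGroup.transvection_coe]
          simp [mul_add, add_mul, hij, hij.symm, hli, hlj, Ne.symm hli, Ne.symm hlj]
          abel
        rw [e, derivedSeries_succ]
        exact Subgroup.commutator_mem_commutator (ih _ _ _ _) (ih _ _ _ _)
    exact this i j hij 1
  · intro hsol
    have : Nontrivial (SL 2 (ZMod p)) := ⟨_, _, hne⟩
    have h3 := hp2 rfl
    have hc := SL2.commutator_eq_top (F := ZMod p) (a := 2) (by
      intro h
      have : ((2 : ℕ) : ZMod p) = 0 := by exact_mod_cast h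
      rw [ZMod.natCast_eq_zero_iff] at this
      have := Nat.le_of_dvd (by norm_num) this
      omega) (by
      intro h
      have : ((3 : ℕ) : ZMod p) = 0 := by
        push_cast
        linear_combination h
      rw [ZMod.natCast_eq_zero_iff] at this
      have := Nat.le_of_dvd (by norm_num) this
      omega)
    exact (Group.IsSolvable.commutator_lt_top_of_nontrivial (SL 2 (ZMod p))).ne hc

theorem not_solvable_of {n p : ℕ} (hp : p.Prime) (hn : 2 ≤ n) (hp2 : n = 2 → 3 < p)
    (H : Subgroup (SL n ℤ)) (hsurj : H.map (redMod n p) = ⊤) : ¬ Group.IsSolvable H := by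
  intro hs
  apply not_solvable_SL hp hn hp2
  refine Group.isSolvable_of_surjective (f := (redMod n p).comp H.subtype) ?_
  intro g
  have hg : g ∈ H.map (redMod n p) := by rw [hsurj]; trivial
  obtain ⟨h, hh, rfl⟩ := hg
  exact ⟨⟨h, hh⟩, rfl⟩

theorem matQ_mulVec_cast {n : ℕ} (h : SL n ℤ) (w : Fin n → ℤ) :
    matQ h *ᵥ (fun i => (w i : ℚ)) =
      fun i => ((((h : Matrix (Fin n) (Fin n) ℤ) *ᵥ w) i : ℤ) : ℚ) := by
  ext i
  simp [matQ, Matrix.mulVec, dotProduct]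

theorem matQ_inv_mulVec {n : ℕ} (h : SL n ℤ) (x : Fin n → ℚ) :
    matQ h⁻¹ *ᵥ (matQ h *ᵥ x) = x := by
  rw [Matrix.mulVec_mulVec, ← matQ_mul, inv_mul_cancel, matQ_one, Matrix.one_mulVec]

theorem matQ_injective {n : ℕ} : Function.Injective (matQ (n := n)) := by
  intro g h hgh
  exact Subtype.ext (map_cast_inj hgh)

theorem cast_dot {n : ℕ} (u w : Fin n → ℤ) :
    ((∑ i, w i * u i : ℤ) : ℚ) = ∑ i, (w i : ℚ) * (u i : ℚ) := by push_cast; rfl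

/-- If `h` maps a primitive vector to a multiple of a primitive vector, the multiple is `±1`. -/
theorem scalar_unit {n : ℕ} (h : SL n ℤ) (w u w' u' : Fin n → ℤ) (hu : ∑ i, w i * u i = 1)
    (hu' : ∑ i, w' i * u' i = 1) (c : ℚ)
    (hc : matQ h *ᵥ (fun i => (w i : ℚ)) = c • (fun i => (w' i : ℚ))) : c = 1 ∨ c = -1 := by
  have h1 : c = ((∑ i, ((h : Matrix (Fin n) (Fin n) ℤ) *ᵥ w) i * u' i : ℤ) : ℚ) := by
    rw [cast_dot]
    have e : ∀ i, ((((h : Matrix (Fin n) (Fin n) ℤ) *ᵥ w) i : ℤ) : ℚ) = c * w' i := by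
      intro i
      rw [matQ_mulVec_cast] at hc
      exact congrFun hc i
    simp only [e, mul_assoc]
    rw [← Finset.mul_sum, ← cast_dot, hu']
    simp
  have h2 : 1 = c * ((∑ i, (((h⁻¹ : SL n ℤ) : Matrix (Fin n) (Fin n) ℤ) *ᵥ w') i * u i : ℤ) : ℚ) := by
    have e := matQ_inv_mulVec h (fun i => (w i : ℚ))
    rw [hc, Matrix.mulVec_smul, matQ_mulVec_cast] at e
    have e' : ∀ i, (w i : ℚ) =
        c * (((((h⁻¹ : SL n ℤ) : Matrix (Fin n) (Fin n) ℤ) *ᵥ w') i : ℤ) : ℚ) := by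
      intro i
      exact (congrFun e i).symm
    have : ((∑ i, w i * u i : ℤ) : ℚ) = 1 := by rw [hu]; simp
    rw [← this, cast_dot, cast_dot, Finset.mul_sum]
    refine Finset.sum_congr rfl fun i _ => ?_
    rw [e' i, mul_assoc]
  rw [h1] at h2 ⊢
  have h3 := Int.isUnit_iff.mp (IsUnit.of_mul_eq_one _ (by exact_mod_cast h2.symm))
  rcases h3 with h3 | h3
  · left; rw [h3]; simp
  · right; rw [h3]; simp

theorem finite_of_monomial {n m : ℕ} (H : Subgroup (SL n ℤ))
    (W : Fin m → Submodule ℚ (Fin n → ℚ)) (hW1 : ∀ i, Module.finrank ℚ (W i) = 1)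
    (htop : iSup W = ⊤)
    (hperm : ∀ g ∈ H, ∀ i, ∃ j, (W i).map (Matrix.toLin' (matQ g)) = W j) : Finite H := by
  have hex : ∀ i, ∃ w u : Fin n → ℤ, ∑ k, w k * u k = 1 ∧
      W i = Submodule.span ℚ {fun k => (w k : ℚ)} := by
    intro i
    obtain ⟨v, hv, hv0⟩ := Submodule.exists_mem_ne_zero_of_ne_bot (p := W i) (by
      intro h
      have := hW1 i
      rw [h] at this
      simp at this)
    obtain ⟨c, w, u, hc, hw, hu⟩ := exists_primitive v hv0
    have hw' : (fun k => (w k : ℚ)) = c • v := by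
      ext k; exact (hw k).symm
    refine ⟨w, u, hu, ?_⟩
    have hle : Submodule.span ℚ {fun k => (w k : ℚ)} ≤ W i := by
      rw [Submodule.span_singleton_le_iff_mem, hw']
      exact (W i).smul_mem _ hv
    symm
    apply Submodule.eq_of_le_of_finrank_eq hle
    rw [hW1, finrank_span_singleton]
    rw [hw']
    exact smul_ne_zero hc hv0
  choose w u hu hspan using hex
  let v : Fin m → Fin n → ℚ := fun i k => (w i k : ℚ)
  let S : Set (Fin n → ℚ) := Set.range v ∪ Set.range (fun i => - v i)
  have hS : S.Finite := (Set.finite_range _).union (Set.finite_range _)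
  let F : H → Fin m → Fin n → ℚ := fun h i => matQ (h : SL n ℤ) *ᵥ v i
  have hF : ∀ h i, F h i ∈ S := by
    rintro ⟨h, hh⟩ i
    obtain ⟨j, hj⟩ := hperm h hh i
    have h1 : matQ h *ᵥ v i ∈ W j := by
      rw [← hj]
      refine ⟨v i, ?_, by simp⟩
      rw [hspan i]
      exact Submodule.mem_span_singleton_self _
    rw [hspan j, Submodule.mem_span_singleton] at h1
    obtain ⟨c, hc⟩ := h1
    have hFe : F ⟨h, hh⟩ i = c • v j := hc.symm
    rw [hFe]
    rcases scalar_unit h (w i) (u i) (w j) (u j) (hu i) (hu j) c hc.symm with rfl | rfl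
    · left; exact ⟨j, by simp⟩
    · right; exact ⟨j, by simp⟩
  have hfin : (Set.range F).Finite := by
    refine (Set.Finite.pi' (fun _ : Fin m => hS)).subset ?_
    rintro _ ⟨h, rfl⟩ i
    exact hF h i
  have hinj : Function.Injective F := by
    intro g h hgh
    apply Subtype.ext
    apply matQ_injective
    apply Matrix.toLin'.injective
    have : (⊤ : Submodule ℚ (Fin n → ℚ)) ≤ LinearMap.eqLocus
        (Matrix.toLin' (matQ (g : SL n ℤ))) (Matrix.toLin' (matQ (h : SL n ℤ))) := by
      rw [← htop]
      refine iSup_le fun i => ?_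
      rw [hspan i, Submodule.span_singleton_le_iff_mem]
      have := congrFun hgh i
      simpa [F, v, LinearMap.mem_eqLocus] using this
    exact LinearMap.ext fun x => this (Submodule.mem_top (x := x))
  have := hfin.to_subtype
  exact Finite.of_injective (Set.rangeFactorization F) (fun a b hab =>
    hinj (congrArg Subtype.val hab))

theorem not_imprimitive_of {n p : ℕ} (hp : p.Prime) (hn : n.Prime) (hp2 : n = 2 → 3 < p)
    (H : Subgroup (SL n ℤ)) (hsurj : H.map (redMod n p) = ⊤) : ¬ ImprimitiveQ H := by
  rintro ⟨m, hm, W, hW0, hint, hperm⟩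
  have hirr := irreducible_of hp hn.two_le H hsurj
  have hinf := infinite_of hp hn.two_le hp2 H hsurj
  have htop := hint.submodule_iSup_eq_top
  have hind := hint.submodule_iSupIndep
  let i0 : Fin m := ⟨0, by omega⟩
  have hrank : ∀ g ∈ H, ∀ i j, (W i).map (Matrix.toLin' (matQ g)) = W j →
      Module.finrank ℚ (W j) = Module.finrank ℚ (W i) := by
    intro g _ i j hij
    rw [← hij]
    refine ((W i).equivMapOfInjective (Matrix.toLin' (matQ g)) ?_).finrank_eq.symm
    refine Function.LeftInverse.injective (g := fun x => matQ g⁻¹ *ᵥ x) fun x => ?_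
    simpa using matQ_inv_mulVec g x
  have hU := hirr (⨆ (i) (_ : Module.finrank ℚ (W i) = Module.finrank ℚ (W i0)), W i) (by
    intro g hg
    rw [Submodule.map_iSup]
    refine iSup_le fun i => ?_
    rw [Submodule.map_iSup]
    refine iSup_le fun hi => ?_
    obtain ⟨j, hj⟩ := hperm g hg i
    rw [hj]
    exact le_iSup₂_of_le j ((hrank g hg i j hj).trans hi) le_rfl)
  have hU' := hU.resolve_left (by
    intro h
    apply hW0 i0
    rw [eq_bot_iff, ← h]
    exact le_iSup₂_of_le i0 rfl le_rfl)
  have hall : ∀ j, Module.finrank ℚ (W j) = Module.finrank ℚ (W i0) := by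
    intro j
    by_contra hj
    apply hW0 j
    have h1 : (⊤ : Submodule ℚ (Fin n → ℚ)) ≤ ⨆ (k) (_ : k ≠ j), W k := by
      rw [← hU']
      refine iSup₂_le fun i hi => ?_
      exact le_iSup₂_of_le i (by rintro rfl; exact hj hi) le_rfl
    have h2 := hind j
    rw [top_le_iff.mp h1] at h2
    simpa using h2
  have hsum : n = m * Module.finrank ℚ (W i0) := by
    have h1 := (LinearEquiv.ofBijective (DirectSum.coeLinearMap W) hint).finrank_eq
    rw [Module.finrank_directSum] at h1
    simpa [hall] using h1.symm
  have hd : Module.finrank ℚ (W i0) = 1 := by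
    have hdvd : m ∣ n := ⟨_, hsum⟩
    rcases (Nat.dvd_prime hn).mp hdvd with h | h
    · omega
    · subst h
      have := hn.pos
      exact Nat.eq_of_mul_eq_mul_left this (by omega)
  have := finite_of_monomial H W (fun i => (hall i).trans hd) htop hperm
  exact not_finite H

end SurjModP

/-- If `φ_p(H) = SL(n,ℤ/pℤ)` for a prime `p` (with `p > 3` if `n = 2`),
then `H` is infinite, non-solvable, and primitive; and for `n > 2` it is not an
isometry group. -/
theorem surjective_mod_p_properties (n p : ℕ) (hn : n.Prime) (hp : p.Prime)
    (hp2 : n = 2 → 3 < p) (H : Subgroup (SL n ℤ)) (hsurj : H.map (redMod n p) = ⊤) :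
    Infinite H ∧ ¬ IsSolvable H ∧ PrimitiveQ H ∧ (2 < n → ¬ IsometryGroupQ H) := by
  refine ⟨SurjModP.infinite_of hp hn.two_le hp2 H hsurj,
    SurjModP.not_solvable_of hp hn.two_le hp2 H hsurj,
    ⟨SurjModP.irreducible_of hp hn.two_le H hsurj,
      SurjModP.not_imprimitive_of hp hn hp2 H hsurj⟩, ?_⟩
  rintro h2 ⟨A, hA, hinv⟩
  have : Nonempty (Fin n) := ⟨⟨0, by omega⟩⟩
  exact SurjModP.no_form hp h2 H hsurj A hA.ne_zero hinv
end
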